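/- arXiv:2009.02953 — 3 statements merged into one kernel-verified Lean document; each statement's English description precedes it below -/
import Mathlib

section
/- For every integer t ≥ 2 there exists a constant C(t) such that every K_{1,t}-free graph G with at least one vertex satisfies χ_s(G) ≤ C(t)·ω(G)^{3(t-1)/2}. In particular, the class of all K_{1,t}-free graphs is χ_s-bounded with a polynomial binding function. -/
open SimpleGraph

/-! ## Basic containment relations between graphs -/

/-- `H` is isomorphic to a (not necessarily induced) subgraph of `G`. -/
def IsSubgraphOf {V W : Type*} (H : SimpleGraph V) (G : SimpleGraph W) : Prop :=
  ∃ f : H →g G, Function.Injective f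

/-- `H` is isomorphic to an induced subgraph of `G`. -/
def IsInducedSubgraphOf {V W : Type*} (H : SimpleGraph V) (G : SimpleGraph W) : Prop :=
  Nonempty (H ↪g G)

/-- The clique number `ω(G)`: the largest `m` such that `K_m` is a subgraph of `G`. -/
noncomputable def omegaNum {V : Type*} (G : SimpleGraph V) : ℕ :=
  sSup {m | IsSubgraphOf (⊤ : SimpleGraph (Fin m)) G}

/-- The chromatic number `χ(G)` (as a natural number). -/
noncomputable def chi {V : Type*} (G : SimpleGraph V) : ℕ :=
  sInf {N | G.Colorable N}

/-! ## Tree-depth and the invariants `χ_p` -/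

/-- A forest order: a partial order in which the down-set of every element is a chain.
Such orders are exactly the ancestor orders of rooted forests. -/
def IsForestOrder {V : Type*} (r : V → V → Prop) : Prop :=
  (∀ v, r v v) ∧ (∀ u v, r u v → r v u → u = v) ∧
  (∀ u v w, r u v → r v w → r u w) ∧
  (∀ u v w, r u w → r v w → r u v ∨ r v u)

/-- `G` has tree-depth at most `h`: `G` is a subgraph of the closure of a rooted forest
of height at most `h` (height = maximum number of vertices on a root-to-leaf path). -/
def TreeDepthLE {V : Type*} (G : SimpleGraph V) (h : ℕ) : Prop :=
  ∃ r : V → V → Prop, IsForestOrder r ∧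
    (∀ u v, G.Adj u v → r u v ∨ r v u) ∧
    (∀ v, {u | r u v}.ncard ≤ h)

/-- The tree-depth `td(G)`. -/
noncomputable def treeDepth {V : Type*} (G : SimpleGraph V) : ℕ :=
  sInf {h | TreeDepthLE G h}

/-- `χ_p(G)`: the least number of colors of a vertex coloring such that every set `I` of at
most `p` colors induces a subgraph of tree-depth at most `|I|`. -/
noncomputable def chiP {V : Type*} (G : SimpleGraph V) (p : ℕ) : ℕ :=
  sInf {N | ∃ c : V → Fin N, ∀ I : Finset (Fin N), I.card ≤ p →
    TreeDepthLE (G.induce {v | c v ∈ I}) I.card}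

/-! ## Star colorings -/

/-- A star coloring: a proper coloring with no path on `4` vertices using only two colors. -/
def IsStarColoring {V α : Type*} (G : SimpleGraph V) (c : V → α) : Prop :=
  (∀ u v, G.Adj u v → c u ≠ c v) ∧
  ∀ x y z w : V, G.Adj x y → G.Adj y z → G.Adj z w →
    x ≠ z → y ≠ w → x ≠ w → ¬(c x = c z ∧ c y = c w)

/-- The star chromatic number `χ_s(G)`. -/
noncomputable def starChi {V : Type*} (G : SimpleGraph V) : ℕ :=
  sInf {N | ∃ c : V → Fin N, IsStarColoring G c}

/-! ## Subdivisions -/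

/-- The edges of a graph on `Fin n`, presented as increasingly ordered pairs. -/
def Edges {n : ℕ} (H : SimpleGraph (Fin n)) : Type :=
  {p : Fin n × Fin n // p.1 < p.2 ∧ H.Adj p.1 p.2}

/-- Base relation of the subdivision of `H`, where the edge `e` receives `t e` internal
vertices. -/
def subdivRel {n : ℕ} (H : SimpleGraph (Fin n)) (t : Edges H → ℕ) :
    (Fin n ⊕ Σ e : Edges H, Fin (t e)) → (Fin n ⊕ Σ e : Edges H, Fin (t e)) → Prop
  | Sum.inl u, Sum.inl v => ∃ h : u < v ∧ H.Adj u v, t ⟨(u, v), h⟩ = 0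
  | Sum.inl u, Sum.inr ⟨e, i⟩ =>
      (u = e.1.1 ∧ (i : ℕ) = 0) ∨ (u = e.1.2 ∧ (i : ℕ) + 1 = t e)
  | Sum.inr ⟨e, i⟩, Sum.inr ⟨e', j⟩ => e = e' ∧ (i : ℕ) + 1 = (j : ℕ)
  | _, _ => False

/-- The subdivision of `H` in which each edge `e` is replaced by a path with exactly `t e`
internal vertices. In particular `Subdiv H (fun _ => r)` is the `r`-subdivision `H^{(r)}`,
and the `(≤ r)`-subdivisions of `H` are the graphs `Subdiv H t` with `t e ≤ r` for all `e`. -/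
def Subdiv {n : ℕ} (H : SimpleGraph (Fin n)) (t : Edges H → ℕ) :
    SimpleGraph (Fin n ⊕ Σ e : Edges H, Fin (t e)) :=
  SimpleGraph.fromRel (subdivRel H t)

/-- `H ∈ TM_r(G)`: some `(≤ r)`-subdivision of `H` is a subgraph of `G`. -/
def MemTM {W : Type*} (r : ℕ) (G : SimpleGraph W) {n : ℕ} (H : SimpleGraph (Fin n)) : Prop :=
  ∃ t : Edges H → ℕ, (∀ e, t e ≤ r) ∧ IsSubgraphOf (Subdiv H t) G

/-- `H ∈ ITM_r^e(G)`: the exact `r`-subdivision of `H` is an induced subgraph of `G`. -/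
def MemITM {W : Type*} (r : ℕ) (G : SimpleGraph W) {n : ℕ} (H : SimpleGraph (Fin n)) : Prop :=
  IsInducedSubgraphOf (Subdiv H (fun _ => r)) G

/-- `ω(TM_r(G))`: the supremum of the clique numbers of the graphs in `TM_r(G)`. -/
noncomputable def omegaTM {W : Type*} (r : ℕ) (G : SimpleGraph W) : ℕ :=
  sSup {m | ∃ (k : ℕ) (H : SimpleGraph (Fin k)), MemTM r G H ∧ omegaNum H = m}

/-- The biclique number `bω(G)`: the largest `s` with `K_{s,s}` a subgraph of `G`. -/
noncomputable def bomega {V : Type*} (G : SimpleGraph V) : ℕ :=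
  sSup {s | IsSubgraphOf (completeBipartiteGraph (Fin s) (Fin s)) G}

/-- The average degree `d̄(G) = 2|E(G)|/|V(G)|`. -/
noncomputable def avgDeg {n : ℕ} (G : SimpleGraph (Fin n)) : ℝ :=
  2 * (G.edgeSet.ncard : ℝ) / n

/-! ## Classes of graphs -/

/-- A class of (finite, simple) graphs: for each `n`, a set of graphs on `Fin n`.
Classes are implicitly closed under isomorphism via the relations used below. -/
def GraphClass := ∀ n : ℕ, Set (SimpleGraph (Fin n))

/-- A hereditary class: closed under induced subgraphs (hence under isomorphism). -/
def Hereditary (C : GraphClass) : Prop :=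
  ∀ ⦃n m : ℕ⦄ (G : SimpleGraph (Fin n)) (H : SimpleGraph (Fin m)),
    G ∈ C n → IsInducedSubgraphOf H G → H ∈ C m

/-- A monotone class: closed under subgraphs (hence under isomorphism). -/
def MonotoneClass (C : GraphClass) : Prop :=
  ∀ ⦃n m : ℕ⦄ (G : SimpleGraph (Fin n)) (H : SimpleGraph (Fin m)),
    G ∈ C n → IsSubgraphOf H G → H ∈ C m

/-- `H ∈ TM_r(𝒞)`. -/
def MemTMClass (r : ℕ) (C : GraphClass) {m : ℕ} (H : SimpleGraph (Fin m)) : Prop :=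
  ∃ (n : ℕ) (G : SimpleGraph (Fin n)), G ∈ C n ∧ MemTM r G H

/-- `H ∈ ITM_r^e(𝒞)`. -/
def MemITMClass (r : ℕ) (C : GraphClass) {m : ℕ} (H : SimpleGraph (Fin m)) : Prop :=
  ∃ (n : ℕ) (G : SimpleGraph (Fin n)), G ∈ C n ∧ MemITM r G H

/-- `𝒞` is `χ`-bounded: `χ(H) ≤ f(ω(H))` for every induced subgraph `H` of a graph of `𝒞`. -/
def ChiBounded (C : GraphClass) : Prop :=
  ∃ f : ℕ → ℕ, ∀ ⦃n : ℕ⦄ (G : SimpleGraph (Fin n)), G ∈ C n →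
    ∀ ⦃m : ℕ⦄ (H : SimpleGraph (Fin m)), IsInducedSubgraphOf H G →
      chi H ≤ f (omegaNum H)

/-- `𝒞` has bounded expansion: for every `r`, `d̄(TM_r(𝒞)) < ∞`. -/
def BoundedExpansion (C : GraphClass) : Prop :=
  ∀ r : ℕ, ∃ d : ℝ, ∀ ⦃m : ℕ⦄ (H : SimpleGraph (Fin m)), MemTMClass r C H → avgDeg H ≤ d

/-- `𝒞` has `ω`-bounded expansion. -/
def OmegaBoundedExpansion (C : GraphClass) : Prop :=
  ∃ f : ℕ → ℕ → ℝ, ∀ ⦃n : ℕ⦄ (G : SimpleGraph (Fin n)), G ∈ C n →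
    ∀ (r : ℕ) ⦃m : ℕ⦄ (H : SimpleGraph (Fin m)), MemTM r G H →
      avgDeg H ≤ f (omegaNum G) r

/-- `𝒞` is nowhere dense: for every `r`, `ω(TM_r(𝒞)) < ∞`. -/
def NowhereDense (C : GraphClass) : Prop :=
  ∀ r : ℕ, ∃ c : ℕ, ∀ ⦃m : ℕ⦄ (H : SimpleGraph (Fin m)), MemTMClass r C H → omegaNum H ≤ c

/-- `𝒞` is strongly `χ_p`-bounded: `χ_p(G) ≤ f_p(ω(G))` on `𝒞`. -/
def StronglyChiPBounded (C : GraphClass) (p : ℕ) : Prop :=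
  ∃ f : ℕ → ℕ, ∀ ⦃n : ℕ⦄ (G : SimpleGraph (Fin n)), G ∈ C n → chiP G p ≤ f (omegaNum G)

/-- `𝒞` is weakly `χ_p`-bounded: `χ_p(G) ≤ g_p(ω(TM_{p-1}(G)))` on `𝒞`. -/
def WeaklyChiPBounded (C : GraphClass) (p : ℕ) : Prop :=
  ∃ g : ℕ → ℕ, ∀ ⦃n : ℕ⦄ (G : SimpleGraph (Fin n)), G ∈ C n → chiP G p ≤ g (omegaTM (p - 1) G)

/-! ## Directed graphs, orientations and restricted dualities -/

/-- Existence of a homomorphism between directed graphs presented as binary relations. -/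
def DigraphHomEx {n m : ℕ} (A : Fin n → Fin n → Prop) (B : Fin m → Fin m → Prop) : Prop :=
  ∃ f : Fin n → Fin m, ∀ u v, A u v → B (f u) (f v)

/-- `A` is an orientation of the graph `G`. -/
def IsOrientationOf {n : ℕ} (A : Fin n → Fin n → Prop) (G : SimpleGraph (Fin n)) : Prop :=
  (∀ u v, ¬(A u v ∧ A v u)) ∧ (∀ u v, G.Adj u v ↔ (A u v ∨ A v u))

/-- A directed graph is acyclic if it has no directed cycle. -/
def IsAcyclicDigraph {n : ℕ} (A : Fin n → Fin n → Prop) : Prop :=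
  ∀ v, ¬ Relation.TransGen A v v

/-- The directed graph `F` has a restricted dual for the class of all orientations of the
graphs of `𝒞`. -/
def HasRestrictedDualForOrientations (C : GraphClass) {nF : ℕ}
    (F : Fin nF → Fin nF → Prop) : Prop :=
  ∃ (m : ℕ) (D : Fin m → Fin m → Prop),
    ¬ DigraphHomEx F D ∧
    ∀ ⦃n : ℕ⦄ (A : Fin n → Fin n → Prop) (G : SimpleGraph (Fin n)),
      G ∈ C n → IsOrientationOf A G →
      (¬ DigraphHomEx F A ↔ DigraphHomEx A D)

/-! ## Holes -/

/-- The number `h_g(G)` of holes of length `g` in `G`, i.e. of vertex subsets inducing a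
cycle on `g` vertices. -/
noncomputable def holeCount {n : ℕ} (g : ℕ) (G : SimpleGraph (Fin n)) : ℕ :=
  {S : Set (Fin n) | Nonempty (G.induce S ≃g SimpleGraph.cycleGraph g)}.ncard

/-- `G` is even hole-free: it has no induced cycle of even length at least `4`. -/
def EvenHoleFree {n : ℕ} (G : SimpleGraph (Fin n)) : Prop :=
  ∀ g : ℕ, 4 ≤ g → Even g → holeCount g G = 0

/-! ## Ramsey bound on the degree -/

/-- The Erdős–Szekeres bound `R(a + 1, b + 1) ≤ (a + b).choose a`, inside a finite vertex set. -/
theorem exists_clique_or_indep_of_choose_le_card {V : Type*} [DecidableEq V] (G : SimpleGraph V)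
    (a b : ℕ) (S : Finset V) (h : (a + b).choose a ≤ S.card) :
    (∃ A ⊆ S, G.IsNClique (a + 1) A) ∨ ∃ B ⊆ S, G.IsNIndepSet (b + 1) B := by
  classical
  induction a generalizing b S with
  | zero =>
    obtain ⟨v, hv⟩ : S.Nonempty := Finset.card_pos.1 (by simpa using h)
    exact Or.inl ⟨{v}, by simpa using hv, by simp [isNClique_iff]⟩
  | succ a iha =>
    induction b generalizing S with
    | zero =>
      obtain ⟨v, hv⟩ : S.Nonempty := Finset.card_pos.1 (by simpa using h)
      exact Or.inr ⟨{v}, by simpa using hv, by simp [isNIndepSet_iff]⟩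
    | succ b ihb =>
      have hrec : (a + 1 + (b + 1)).choose (a + 1) =
          (a + (b + 1)).choose a + (a + 1 + b).choose (a + 1) := by
        rw [show a + 1 + (b + 1) = (a + (b + 1)) + 1 by ring, Nat.choose_succ_succ,
          show a + 1 + b = a + (b + 1) by ring]
      obtain ⟨v, hv⟩ : S.Nonempty := Finset.card_pos.1
        (lt_of_lt_of_le (Nat.choose_pos (by omega)) h)
      have hsplit : ((S.erase v).filter (G.Adj v)).card +
          ((S.erase v).filter (fun u => ¬ G.Adj v u)).card + 1 = S.card := by
        rw [Finset.card_filter_add_card_filter_not, Finset.card_erase_add_one hv]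
      by_cases hA : (a + (b + 1)).choose a ≤ ((S.erase v).filter (G.Adj v)).card
      · rcases iha _ _ hA with ⟨A, hAS, hAc⟩ | ⟨B, hBS, hBi⟩
        · refine Or.inl ⟨insert v A, ?_, hAc.insert fun u hu => ?_⟩
          · intro u hu
            rcases Finset.mem_insert.1 hu with rfl | hu
            · exact hv
            · exact Finset.mem_of_mem_erase (Finset.mem_filter.1 (hAS hu)).1
          · exact (Finset.mem_filter.1 (hAS hu)).2
        · exact Or.inr ⟨B, fun u hu =>
            Finset.mem_of_mem_erase (Finset.mem_filter.1 (hBS hu)).1, hBi⟩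
      · rcases ihb ((S.erase v).filter (fun u => ¬ G.Adj v u)) (by omega) with
          ⟨A, hAS, hAc⟩ | ⟨B, hBS, hBi⟩
        · exact Or.inl ⟨A, fun u hu =>
            Finset.mem_of_mem_erase (Finset.mem_filter.1 (hAS hu)).1, hAc⟩
        · have hvB : ∀ u ∈ B, u ≠ v ∧ ¬ G.Adj v u := fun u hu =>
            ⟨Finset.ne_of_mem_erase (Finset.mem_filter.1 (hBS hu)).1,
              (Finset.mem_filter.1 (hBS hu)).2⟩
          refine Or.inr ⟨insert v B, ?_, ?_, ?_⟩
          · intro u hu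
            rcases Finset.mem_insert.1 hu with rfl | hu
            · exact hv
            · exact Finset.mem_of_mem_erase (Finset.mem_filter.1 (hBS hu)).1
          · rw [Finset.coe_insert]
            exact Set.pairwise_insert.2 ⟨hBi.1, fun u hu _ =>
              ⟨(hvB u hu).2, fun h => (hvB u hu).2 h.symm⟩⟩
          · rw [Finset.card_insert_of_notMem fun hvm => (hvB v hvm).1 rfl, hBi.2]

theorem le_omegaNum_of_isNClique {V : Type*} [Fintype V] {G : SimpleGraph V} {m : ℕ}
    {A : Finset V} (hA : G.IsNClique m A) : m ≤ omegaNum G := by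
  have hbdd : BddAbove {m | IsSubgraphOf (⊤ : SimpleGraph (Fin m)) G} := by
    refine ⟨Fintype.card V, ?_⟩
    rintro k ⟨f, hf⟩
    simpa using Fintype.card_le_of_injective f hf
  refine le_csSup hbdd ?_
  let e := A.equivFinOfCardEq hA.card_eq
  refine ⟨⟨fun i => (e.symm i : V), fun {i j} hij => ?_⟩, fun i j hij => ?_⟩
  · exact hA.isClique (e.symm i).2 (e.symm j).2 fun h =>
      hij.ne (e.symm.injective (Subtype.ext h))
  · exact e.symm.injective (Subtype.ext hij)

theorem one_le_omegaNum {V : Type*} [Fintype V] [Nonempty V] (G : SimpleGraph V) :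
    1 ≤ omegaNum G := by
  obtain ⟨v⟩ := ‹Nonempty V›
  exact le_omegaNum_of_isNClique (A := {v}) (by simp [isNClique_iff])

theorem isInducedSubgraphOf_star {V : Type*} {G : SimpleGraph V} {t : ℕ} {v : V} {B : Finset V}
    (hB : G.IsNIndepSet t B) (hv : ∀ u ∈ B, G.Adj v u) :
    IsInducedSubgraphOf (completeBipartiteGraph (Fin 1) (Fin t)) G := by
  let e := B.equivFinOfCardEq hB.card_eq
  have hadj : ∀ i, G.Adj v (e.symm i) := fun i => hv _ (e.symm i).2
  have hnadj : ∀ i j, ¬ G.Adj (e.symm i : V) (e.symm j) := fun i j h =>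
    hB.isIndepSet (e.symm i).2 (e.symm j).2 h.ne h
  refine ⟨⟨⟨Sum.elim (fun _ => v) (fun i => (e.symm i : V)), ?_⟩, ?_⟩⟩
  · rintro (i | i) (j | j) hij
    · exact congrArg _ (Subsingleton.elim i j)
    · exact absurd hij (hadj j).ne
    · exact absurd hij (hadj i).ne'
    · exact congrArg _ (e.symm.injective (Subtype.ext hij))
  · rintro (i | i) (j | j)
    · exact iff_of_false G.irrefl (by simp)
    · exact iff_of_true (hadj j) (by simp)
    · exact iff_of_true (hadj i).symm (by simp)
    · exact iff_of_false (hnadj i j) (by simp)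

theorem degree_le_of_star_free {V : Type*} [Fintype V] [DecidableEq V] (G : SimpleGraph V)
    [DecidableRel G.Adj] {t : ℕ} (ht : 2 ≤ t)
    (hG : ¬ IsInducedSubgraphOf (completeBipartiteGraph (Fin 1) (Fin t)) G) (v : V) :
    G.degree v ≤ (t * omegaNum G) ^ (t - 1) := by
  have : Nonempty V := ⟨v⟩
  obtain ⟨a, ha⟩ := Nat.exists_eq_add_of_le' (one_le_omegaNum G)
  obtain ⟨b, rfl⟩ := Nat.exists_eq_add_of_le' (le_of_lt ht)
  have hlt : G.degree v < (a + b).choose a := by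
    by_contra! hle
    rcases exists_clique_or_indep_of_choose_le_card G a b (G.neighborFinset v) hle with
      ⟨A, hAS, hA⟩ | ⟨B, hBS, hB⟩
    · have := le_omegaNum_of_isNClique
        (hA.insert (a := v) fun u hu => (G.mem_neighborFinset v u).1 (hAS hu))
      omega
    · exact hG (isInducedSubgraphOf_star hB fun u hu => (G.mem_neighborFinset v u).1 (hBS hu))
  calc G.degree v ≤ (a + b).choose b := by rw [← Nat.choose_symm_add]; exact hlt.le
    _ ≤ (a + b) ^ b := Nat.choose_le_pow _ _
    _ ≤ _ := by
      rw [ha, Nat.add_sub_cancel]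
      exact Nat.pow_le_pow_left (by nlinarith) b

/-! ## Star colorings of graphs of bounded degree, by counting -/

section Counting

variable {V : Type*}

/-- `c` satisfies the star coloring conditions on the vertices of `S`. -/
def IsStarColoringOn {α : Type*} (G : SimpleGraph V) (S : Finset V) (c : V → α) : Prop :=
  (∀ u ∈ S, ∀ v ∈ S, G.Adj u v → c u ≠ c v) ∧
  ∀ x ∈ S, ∀ y ∈ S, ∀ z ∈ S, ∀ w ∈ S, G.Adj x y → G.Adj y z → G.Adj z w →
    x ≠ z → y ≠ w → x ≠ w → ¬(c x = c z ∧ c y = c w)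

theorem IsStarColoringOn.congr {α : Type*} {G : SimpleGraph V} {S T : Finset V} {c d : V → α}
    (hc : IsStarColoringOn G S c) (hTS : T ⊆ S) (hcd : ∀ u ∈ T, d u = c u) :
    IsStarColoringOn G T d := by
  refine ⟨fun u hu v hv h => ?_, fun x hx y hy z hz w hw => ?_⟩
  · rw [hcd u hu, hcd v hv]
    exact hc.1 u (hTS hu) v (hTS hv) h
  · rw [hcd x hx, hcd y hy, hcd z hz, hcd w hw]
    exact hc.2 x (hTS hx) y (hTS hy) z (hTS hz) w (hTS hw)

variable [Fintype V] [DecidableEq V] (N : ℕ) [NeZero N] (G : SimpleGraph V)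

open Classical in
/-- The functions vanishing off `T` which star color the vertices of `S`. -/
noncomputable def starColorings (S T : Finset V) : Finset (V → Fin N) :=
  {c | (∀ u ∉ T, c u = 0) ∧ IsStarColoringOn G S c}

variable {N G}

theorem mem_starColorings {S T : Finset V} {c : V → Fin N} :
    c ∈ starColorings N G S T ↔ (∀ u ∉ T, c u = 0) ∧ IsStarColoringOn G S c := by
  simp [starColorings]

theorem update_mem_starColorings {S T : Finset V} {v : V} {c : V → Fin N}
    (hc : c ∈ starColorings N G S T) :
    Function.update c v 0 ∈ starColorings N G (S.erase v) (T.erase v) := by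
  rw [mem_starColorings] at hc ⊢
  refine ⟨fun u hu => ?_, hc.2.congr (Finset.erase_subset _ _) fun u hu =>
    Function.update_of_ne (Finset.ne_of_mem_erase hu) _ _⟩
  by_cases huv : u = v
  · simp [huv]
  · rw [Function.update_of_ne huv]
    exact hc.1 u fun h => hu (Finset.mem_erase.2 ⟨huv, h⟩)

theorem card_mul_le_card_starColorings_insert {S : Finset V} {v : V} (hv : v ∉ S) :
    N * (starColorings N G S S).card ≤ (starColorings N G S (insert v S)).card := by
  have hcard : N * (starColorings N G S S).card =
      ((Finset.univ : Finset (Fin N)) ×ˢ starColorings N G S S).card := by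
    simp [Finset.card_product]
  rw [hcard]
  refine Finset.card_le_card_of_injOn (fun p => Function.update p.2 v p.1) ?_ ?_
  · rintro ⟨i, c⟩ hp
    have hc := mem_starColorings.1 (Finset.mem_product.1 (Finset.mem_coe.1 hp)).2
    refine Finset.mem_coe.2 (mem_starColorings.2 ⟨fun u hu => ?_, hc.2.congr subset_rfl
      fun u hu => Function.update_of_ne (ne_of_mem_of_not_mem hu hv) _ _⟩)
    rw [Finset.mem_insert, not_or] at hu
    simpa [Function.update_of_ne hu.1] using hc.1 u hu.2
  · rintro ⟨i, c⟩ hp ⟨j, d⟩ hq h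
    have hc := mem_starColorings.1 (Finset.mem_product.1 (Finset.mem_coe.1 hp)).2
    have hd := mem_starColorings.1 (Finset.mem_product.1 (Finset.mem_coe.1 hq)).2
    refine Prod.ext (by simpa using congrFun h v) (funext fun u => ?_)
    by_cases huv : u = v
    · rw [huv]
      exact (hc.1 v hv).trans (hd.1 v hv).symm
    · simpa [Function.update_of_ne huv] using congrFun h u

theorem card_filter_eq_le {S T : Finset V} {v u : V} (huv : u ≠ v) :
    ((starColorings N G S T).filter fun c => c v = c u).card ≤
      (starColorings N G (S.erase v) (T.erase v)).card := by
  refine Finset.card_le_card_of_injOn (fun c => Function.update c v 0) ?_ ?_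
  · intro c hc
    exact Finset.mem_coe.2 (update_mem_starColorings (Finset.mem_filter.1 hc).1)
  · intro c hc d hd h
    have hne : ∀ x, x ≠ v → c x = d x := fun x hx => by
      simpa [Function.update_of_ne hx] using congrFun h x
    funext x
    by_cases hx : x = v
    · rw [hx, (Finset.mem_filter.1 hc).2, (Finset.mem_filter.1 hd).2, hne u huv]
    · exact hne x hx

theorem card_filter_eq_eq_le {S T : Finset V} {v w y z : V} (hzv : z ≠ v) (hzw : z ≠ w)
    (hyv : y ≠ v) (hyw : y ≠ w) :
    ((starColorings N G S T).filter fun c => c v = c z ∧ c w = c y).card ≤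
      (starColorings N G ((S.erase v).erase w) ((T.erase v).erase w)).card := by
  refine Finset.card_le_card_of_injOn
    (fun c => Function.update (Function.update c v 0) w 0) ?_ ?_
  · intro c hc
    exact Finset.mem_coe.2
      (update_mem_starColorings (update_mem_starColorings (Finset.mem_filter.1 hc).1))
  · intro c hc d hd h
    have hc := (Finset.mem_filter.1 hc).2
    have hd := (Finset.mem_filter.1 hd).2
    have hne : ∀ x, x ≠ v → x ≠ w → c x = d x := fun x hx hx' => by
      simpa [Function.update_of_ne hx, Function.update_of_ne hx'] using congrFun h x
    funext x
    by_cases hx : x = v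
    · rw [hx, hc.1, hd.1, hne z hzv hzw]
    · by_cases hx' : x = w
      · rw [hx', hc.2, hd.2, hne y hyv hyw]
      · exact hne x hx hx'

variable (N G) in
/-- The colorings of `S ∪ {v}`, star on `S`, which fail to be star on `S ∪ {v}` because of
a neighbor of `v`, a path starting at `v`, or a path with second vertex `v`. -/
theorem starColorings_subset [DecidableRel G.Adj] (S : Finset V) (v : V) :
    starColorings N G S (insert v S) ⊆ starColorings N G (insert v S) (insert v S) ∪
      ((G.neighborFinset v).biUnion fun u =>
        (starColorings N G S (insert v S)).filter fun c => v ≠ u ∧ c v = c u) ∪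
      ((G.neighborFinset v).biUnion fun y => (G.neighborFinset y).biUnion fun z =>
        (G.neighborFinset z).biUnion fun w => (starColorings N G S (insert v S)).filter fun c =>
          (w ∈ S ∧ z ≠ v ∧ z ≠ w ∧ y ≠ v ∧ y ≠ w) ∧ c v = c z ∧ c w = c y) ∪
      ((G.neighborFinset v).biUnion fun x => (G.neighborFinset v).biUnion fun z =>
        (G.neighborFinset z).biUnion fun w => (starColorings N G S (insert v S)).filter fun c =>
          (x ∈ S ∧ w ≠ v ∧ w ≠ x ∧ z ≠ v ∧ z ≠ x) ∧ c v = c w ∧ c x = c z) := by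
  intro c hc
  by_contra hbad
  simp only [Finset.mem_union, Finset.mem_biUnion, Finset.mem_filter, not_or, not_exists,
    mem_neighborFinset, not_and] at hbad
  obtain ⟨⟨⟨hnot, h1⟩, h2⟩, h3⟩ := hbad
  have hc' := mem_starColorings.1 hc
  refine hnot (mem_starColorings.2 ⟨hc'.1, ?_, ?_⟩)
  · intro a ha b hb hab heq
    rcases Finset.mem_insert.1 ha with rfl | ha
    · exact h1 b hab hc hab.ne heq
    · rcases Finset.mem_insert.1 hb with rfl | hb
      · exact h1 a hab.symm hc hab.ne' heq.symm
      · exact hc'.2.1 a ha b hb hab heq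
  · rintro x hx y hy z hz w hw hxy hyz hzw hxz hyw hxw ⟨e1, e2⟩
    by_cases hxv : x = v
    · subst hxv
      exact h2 y hxy z hyz w hzw hc ⟨(Finset.mem_insert.1 hw).resolve_left hxw.symm,
        hxz.symm, hzw.ne, hxy.ne', hyw⟩ e1 e2.symm
    · have hxS := (Finset.mem_insert.1 hx).resolve_left hxv
      by_cases hwv : w = v
      · subst hwv
        exact h2 z hzw.symm y hyz.symm x hxy.symm hc ⟨hxS, hyw, hxy.ne', hzw.ne, hxz.symm⟩ e2.symm e1
      · have hwS := (Finset.mem_insert.1 hw).resolve_left hwv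
        by_cases hyv : y = v
        · subst hyv
          exact h3 x hxy.symm z hyz w hzw hc ⟨hxS, hyw.symm, hxw.symm, hyz.ne', hxz.symm⟩ e2 e1
        · have hyS := (Finset.mem_insert.1 hy).resolve_left hyv
          by_cases hzv : z = v
          · subst hzv
            exact h3 w hzw y hyz.symm x hxy.symm hc ⟨hwS, hxz, hxw, hyz.ne, hyw⟩ e1.symm e2.symm
          · exact hc'.2.2 x hxS y hyS z ((Finset.mem_insert.1 hz).resolve_left hzv) w hwS
              hxy hyz hzw hxz hyw hxw ⟨e1, e2⟩

theorem mul_card_starColorings_le [DecidableRel G.Adj] {D β : ℕ}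
    (hD : ∀ v, G.degree v ≤ D) (hβ : D ^ 3 ≤ β ^ 2) (hDβ : D ≤ β) (hN : 4 * β ≤ N) :
    ∀ (S : Finset V), ∀ v ∉ S, β * (starColorings N G S S).card ≤
      (starColorings N G (insert v S) (insert v S)).card := by
  intro S
  induction S using Finset.strongInduction with
  | H S ih =>
  intro v hv
  have herase : ∀ w ∈ S, β * (starColorings N G (S.erase w) (S.erase w)).card ≤
      (starColorings N G S S).card := fun w hw => by
    simpa [Finset.insert_erase hw] using
      ih _ (Finset.erase_ssubset hw) w (Finset.notMem_erase w S)
  set E := starColorings N G S (insert v S) with hE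
  set s := (starColorings N G S S).card with hs
  have hedge : ∀ u, (E.filter fun c => v ≠ u ∧ c v = c u).card ≤ s := fun u => by
    by_cases huv : v = u
    · simp [huv]
    · have := card_filter_eq_le (N := N) (G := G) (S := S) (T := insert v S) (Ne.symm huv)
      rw [Finset.erase_insert hv, Finset.erase_eq_of_notMem hv] at this
      simpa [huv] using this
  have hpath : ∀ w y z, β * (E.filter fun c =>
      (w ∈ S ∧ z ≠ v ∧ z ≠ w ∧ y ≠ v ∧ y ≠ w) ∧ c v = c z ∧ c w = c y).card ≤ s := by
    intro w y z
    by_cases h : w ∈ S ∧ z ≠ v ∧ z ≠ w ∧ y ≠ v ∧ y ≠ w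
    · have := card_filter_eq_eq_le (N := N) (G := G) (S := S) (T := insert v S)
        h.2.1 h.2.2.1 h.2.2.2.1 h.2.2.2.2
      rw [Finset.erase_insert hv, Finset.erase_eq_of_notMem hv] at this
      simp only [h, true_and, ne_eq, not_false_eq_true]
      exact (Nat.mul_le_mul_left β this).trans (herase w h.1)
    · simp [h]
  have hunion : ∀ (p : V) (F : V → Finset (V → Fin N)) (k : ℕ), (∀ u, β * (F u).card ≤ k) →
      β * ((G.neighborFinset p).biUnion F).card ≤ D * k := fun p F k hF => by
    calc β * ((G.neighborFinset p).biUnion F).card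
        ≤ β * ∑ u ∈ G.neighborFinset p, (F u).card :=
          Nat.mul_le_mul_left _ Finset.card_biUnion_le
      _ = ∑ u ∈ G.neighborFinset p, β * (F u).card := Finset.mul_sum _ _ _
      _ ≤ (G.neighborFinset p).card * k := Finset.sum_le_card_nsmul _ _ _ fun u _ => hF u
      _ ≤ D * k := Nat.mul_le_mul_right _ (hD p)
  have hsub := (Finset.card_le_card (starColorings_subset N G S v)).trans
    ((Finset.card_union_le _ _).trans (Nat.add_le_add_right ((Finset.card_union_le _ _).trans
      (Nat.add_le_add_right (Finset.card_union_le _ _) _)) _))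
  have hb1 := hunion v (fun u => E.filter fun c => v ≠ u ∧ c v = c u) (β * s)
    fun u => Nat.mul_le_mul_left _ (hedge u)
  have hb2 := hunion v _ _ fun y => hunion y _ _ fun z => hunion z _ _ fun w => hpath w y z
  have hb3 := hunion v _ _ fun x => hunion v _ _ fun z => hunion z _ _ fun w => hpath x z w
  have hE' : N * s ≤ E.card := card_mul_le_card_starColorings_insert hv
  rw [← hE] at hsub
  rcases Nat.eq_zero_or_pos β with rfl | hβ0
  · simp
  refine le_of_mul_le_mul_left ?_ hβ0
  have hcube : D * (D * (D * s)) ≤ β ^ 2 * s := by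
    calc D * (D * (D * s)) = D ^ 3 * s := by ring
      _ ≤ _ := Nat.mul_le_mul_right _ hβ
  have hsub' := Nat.mul_le_mul_left β (hE'.trans hsub)
  have hlin : D * (β * s) ≤ β ^ 2 * s := by
    calc D * (β * s) ≤ β * (β * s) := Nat.mul_le_mul_right _ hDβ
      _ = _ := by ring
  have hN' : 4 * (β ^ 2 * s) ≤ β * (N * s) := by
    calc 4 * (β ^ 2 * s) = β * (4 * β * s) := by ring
      _ ≤ _ := Nat.mul_le_mul_left _ (Nat.mul_le_mul_right _ hN)
  have hgoal : β * (β * s) = β ^ 2 * s := by ring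
  rw [Nat.mul_add, Nat.mul_add, Nat.mul_add] at hsub'
  rw [hgoal]
  omega

/-- A graph of maximum degree at most `D` has a star coloring with `N` colors as soon as
`N ≥ 4 * β` for some `β ≥ max D (D ^ (3 / 2))`. -/
theorem exists_isStarColoring_of_degree_le [DecidableRel G.Adj] {D β : ℕ}
    (hD : ∀ v, G.degree v ≤ D) (hβ : D ^ 3 ≤ β ^ 2) (hDβ : D ≤ β) (hβ0 : 0 < β)
    (hN : 4 * β ≤ N) : ∃ c : V → Fin N, IsStarColoring G c := by
  have hpos : ∀ S : Finset V, 0 < (starColorings N G S S).card := by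
    intro S
    induction S using Finset.induction_on with
    | empty =>
      exact Finset.card_pos.2 ⟨fun _ => 0, mem_starColorings.2 (by simp [IsStarColoringOn])⟩
    | insert v S hv ih =>
      exact (Nat.mul_pos hβ0 ih).trans_le (mul_card_starColorings_le hD hβ hDβ hN S v hv)
  obtain ⟨c, hc⟩ := Finset.card_pos.1 (hpos Finset.univ)
  have hc := (mem_starColorings.1 hc).2
  exact ⟨c, fun u v => hc.1 u (Finset.mem_univ _) v (Finset.mem_univ _), fun x y z w =>
    hc.2 x (Finset.mem_univ _) y (Finset.mem_univ _) z (Finset.mem_univ _) w (Finset.mem_univ _)⟩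

end Counting

/-- The Fertin–Raspaud–Reed bound `χ_s(G) = O(Δ(G) ^ (3 / 2))`. -/
theorem starChi_le_of_degree_le {V : Type*} [Fintype V] [DecidableEq V] (G : SimpleGraph V)
    [DecidableRel G.Adj] {D : ℕ} (hD0 : 1 ≤ D) (hD : ∀ v, G.degree v ≤ D) :
    (starChi G : ℝ) ≤ 8 * (D : ℝ) ^ (3 / 2 : ℝ) := by
  have hlt : D ^ 3 < (Nat.sqrt (D ^ 3) + 1) ^ 2 := Nat.lt_succ_sqrt' _
  have hDβ : D ≤ Nat.sqrt (D ^ 3) + 1 :=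
    (Nat.le_sqrt'.2 (Nat.pow_le_pow_right hD0 (by norm_num))).trans (Nat.le_succ _)
  have : NeZero (4 * (Nat.sqrt (D ^ 3) + 1)) := ⟨by positivity⟩
  have hchi : starChi G ≤ 4 * (Nat.sqrt (D ^ 3) + 1) :=
    Nat.sInf_le (exists_isStarColoring_of_degree_le hD hlt.le hDβ (Nat.succ_pos _) le_rfl)
  have hD1 : (1 : ℝ) ≤ D := by exact_mod_cast hD0
  have hsqrt : (Nat.sqrt (D ^ 3) : ℝ) ≤ (D : ℝ) ^ (3 / 2 : ℝ) := by
    calc (Nat.sqrt (D ^ 3) : ℝ) ≤ √((D ^ 3 : ℕ) : ℝ) := Real.nat_sqrt_le_real_sqrt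
      _ = (D : ℝ) ^ (3 / 2 : ℝ) := by
        rw [Real.sqrt_eq_rpow, Nat.cast_pow, ← Real.rpow_natCast_mul (by positivity)]
        norm_num
  have hone : (1 : ℝ) ≤ (D : ℝ) ^ (3 / 2 : ℝ) := Real.one_le_rpow hD1 (by norm_num)
  have hchi' : (starChi G : ℝ) ≤ 4 * ((Nat.sqrt (D ^ 3) : ℝ) + 1) := by exact_mod_cast hchi
  linarith

/-- For every integer `t ≥ 2` there is a constant `C(t)` such that every
`K_{1,t}`-free graph `G` with at least one vertex satisfies
`χ_s(G) ≤ C(t) · ω(G)^{3(t-1)/2}`. -/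
theorem star_chromatic_of_K1t_free (t : ℕ) (ht : 2 ≤ t) :
    ∃ C : ℝ, ∀ (n : ℕ) (G : SimpleGraph (Fin n)), 1 ≤ n →
      ¬ IsInducedSubgraphOf (completeBipartiteGraph (Fin 1) (Fin t)) G →
      (starChi G : ℝ) ≤ C * (omegaNum G : ℝ) ^ ((3 * ((t : ℝ) - 1)) / 2) := by
  classical
  refine ⟨8 * (t : ℝ) ^ ((3 * ((t : ℝ) - 1)) / 2), fun n G hn hG => ?_⟩
  have : Nonempty (Fin n) := ⟨⟨0, hn⟩⟩
  have hω := one_le_omegaNum G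
  have hD0 : 1 ≤ (t * omegaNum G) ^ (t - 1) :=
    Nat.one_le_pow _ _ (Nat.mul_pos (by omega) hω)
  refine (starChi_le_of_degree_le G hD0 (degree_le_of_star_free G ht hG)).trans_eq ?_
  rw [mul_assoc, ← Real.mul_rpow (by positivity) (by positivity), Nat.cast_pow, Nat.cast_mul,
    ← Real.rpow_natCast_mul (by positivity), Nat.cast_sub (by omega), Nat.cast_one]
  congr 2
  ring
end

section
/- Let T be a forest and let r ≤ t be positive integers. Then the class of all graphs that are both T-free and K_{r,t}-free is χ_s-bounded if and only if r = 1 or T is a subgraph of the 1-subdivision of some tree. -/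
open SimpleGraph

section Combinatorics

open Classical

/-! ## Sampling, Ramsey and Kővári–Sós–Turán type lemmas -/

/-- If each `e ∈ E` asks for the set `A e` and forbids the disjoint set `B e`, with
`|A e| + |B e| ≤ k`, then some set satisfies at least a `2 ^ (-k)` fraction of `E`. -/
lemma exists_sample {Ω ι : Type*} [Fintype Ω] (E : Finset ι) (A B : ι → Finset Ω) (k : ℕ)
    (hd : ∀ e ∈ E, Disjoint (A e) (B e)) (hc : ∀ e ∈ E, (A e).card + (B e).card ≤ k) :
    ∃ S : Finset Ω, E.card ≤ 2 ^ k * (E.filter fun e => A e ⊆ S ∧ Disjoint (B e) S).card := by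
  by_contra! h
  have h1 : ∑ S : Finset Ω, 2 ^ k * (E.filter fun e => A e ⊆ S ∧ Disjoint (B e) S).card
      < ∑ _S : Finset Ω, E.card :=
    Finset.sum_lt_sum_of_nonempty Finset.univ_nonempty fun S _ => h S
  have h2 : ∑ S : Finset Ω, (E.filter fun e => A e ⊆ S ∧ Disjoint (B e) S).card
      = ∑ e ∈ E, (Finset.univ.filter fun S : Finset Ω => A e ⊆ S ∧ Disjoint (B e) S).card := by
    simp only [Finset.card_filter]
    exact Finset.sum_comm
  have h3 : ∀ e ∈ E, 2 ^ Fintype.card Ω ≤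
      2 ^ k * (Finset.univ.filter fun S : Finset Ω => A e ⊆ S ∧ Disjoint (B e) S).card := by
    intro e he
    have h4 : (Finset.univ.filter fun S : Finset Ω => A e ⊆ S ∧ Disjoint (B e) S)
        = Finset.Icc (A e) (B e)ᶜ := by
      ext S
      simp only [Finset.mem_filter, Finset.mem_univ, true_and, Finset.mem_Icc]
      rw [Finset.subset_compl_comm, ← Finset.subset_compl_iff_disjoint_right]
    have h5 : A e ⊆ (B e)ᶜ := by
      rw [Finset.subset_compl_iff_disjoint_right]; exact hd e he
    rw [h4, Finset.card_Icc_finset h5, Finset.card_compl, ← pow_add]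
    exact Nat.pow_le_pow_right (by norm_num) (by have := hc e he; omega)
  rw [← Finset.mul_sum, h2, Finset.mul_sum] at h1
  have h6 := Finset.sum_le_sum h3
  simp at h6 h1
  rw [mul_comm] at h1
  omega

/-- Finite Ramsey theorem for a clique or an independent set in a finite vertex set. -/
lemma exists_ramsey (a b : ℕ) : ∃ R : ℕ, ∀ {V : Type} (G : SimpleGraph V) (S : Finset V),
    R ≤ S.card → (∃ C ⊆ S, C.card = a ∧ ∀ x ∈ C, ∀ y ∈ C, x ≠ y → G.Adj x y) ∨
      (∃ C ⊆ S, C.card = b ∧ ∀ x ∈ C, ∀ y ∈ C, ¬ G.Adj x y) := by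
  induction a generalizing b with
  | zero => exact ⟨0, fun G S _ => Or.inl ⟨∅, by simp⟩⟩
  | succ a iha =>
    induction b with
    | zero => exact ⟨0, fun G S _ => Or.inr ⟨∅, by simp⟩⟩
    | succ b ihb =>
      obtain ⟨R1, h1⟩ := iha (b + 1)
      obtain ⟨R2, h2⟩ := ihb
      refine ⟨R1 + R2 + 1, fun G S hS => ?_⟩
      obtain ⟨v, hv⟩ : S.Nonempty := Finset.card_pos.mp (by omega)
      have h3 : ((S.erase v).filter (G.Adj v)).card + ((S.erase v).filter (¬ G.Adj v ·)).card
          = (S.erase v).card := Finset.card_filter_add_card_filter_not _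
      rw [Finset.card_erase_of_mem hv] at h3
      rcases (show R1 ≤ ((S.erase v).filter (G.Adj v)).card ∨
        R2 ≤ ((S.erase v).filter (¬ G.Adj v ·)).card by omega) with h | h
      · rcases h1 G _ h with ⟨C, hC, hc, hadj⟩ | ⟨C, hC, hc, hadj⟩
        · left
          refine ⟨insert v C, ?_, ?_, ?_⟩
          · grind
          · rw [Finset.card_insert_of_notMem (by grind), hc]
          · intro x hx y hy hxy
            rcases Finset.mem_insert.mp hx with rfl | hx' <;>
            rcases Finset.mem_insert.mp hy with rfl | hy'
            · exact absurd rfl hxy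
            · exact (Finset.mem_filter.mp (hC hy')).2
            · exact (Finset.mem_filter.mp (hC hx')).2.symm
            · exact hadj x hx' y hy' hxy
        · exact Or.inr ⟨C, by grind, hc, hadj⟩
      · rcases h2 G _ h with ⟨C, hC, hc, hadj⟩ | ⟨C, hC, hc, hadj⟩
        · exact Or.inl ⟨C, by grind, hc, hadj⟩
        · right
          refine ⟨insert v C, ?_, ?_, ?_⟩
          · grind
          · rw [Finset.card_insert_of_notMem (by grind), hc]
          · intro x hx y hy hxy
            rcases Finset.mem_insert.mp hx with rfl | hx' <;>
            rcases Finset.mem_insert.mp hy with rfl | hy'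
            · exact G.loopless.irrefl _ hxy
            · exact (Finset.mem_filter.mp (hC hy')).2 hxy
            · exact (Finset.mem_filter.mp (hC hx')).2 hxy.symm
            · exact hadj x hx' y hy' hxy

/-- `G` has no (not necessarily induced) subgraph `K_{s,s}`. -/
def BicliqueFree {V : Type*} (G : SimpleGraph V) (s : ℕ) : Prop :=
  ¬ ∃ J Z : Finset V, J.card = s ∧ Z.card = s ∧ ∀ j ∈ J, ∀ z ∈ Z, G.Adj j z

/-- In a graph without `K_{s,s}`, only boundedly many vertices are adjacent to a fixed
proportion of a large set. -/
lemma BicliqueFree.card_heavy_lt (s m : ℕ) (hm : 0 < m) : ∃ K N : ℕ, ∀ {V : Type}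
    (G : SimpleGraph V), BicliqueFree G s → ∀ X I : Finset V, N ≤ X.card →
    (∀ i ∈ I, X.card ≤ m * (X.filter (G.Adj i)).card) → I.card < K := by
  refine ⟨2 * m * s + 1, 2 * m * s * 2 ^ (2 * m * s) + 1, fun {V} G hG X I hX hI => ?_⟩
  by_contra! hK
  apply hG
  obtain ⟨I', hI', hcard⟩ := Finset.exists_subset_card_eq (show 2 * m * s ≤ I.card by omega)
  have h1 : ∑ i ∈ I', (X.filter (G.Adj i)).card = ∑ x ∈ X, (I'.filter (G.Adj · x)).card := by
    simp only [Finset.card_filter]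
    exact Finset.sum_comm
  have h2 : I'.card * X.card ≤ m * ∑ i ∈ I', (X.filter (G.Adj i)).card := by
    rw [Finset.mul_sum, ← smul_eq_mul]
    exact Finset.card_nsmul_le_sum _ _ _ fun i hi => hI i (hI' hi)
  set X' := X.filter fun x => s ≤ (I'.filter (G.Adj · x)).card with hX'
  have h3 : ∑ x ∈ X, (I'.filter (G.Adj · x)).card ≤ s * X.card + I'.card * X'.card := by
    have : ∀ x ∈ X, (I'.filter (G.Adj · x)).card ≤ s + if x ∈ X' then I'.card else 0 := by
      intro x hx
      by_cases hx' : s ≤ (I'.filter (G.Adj · x)).card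
      · have : x ∈ X' := by simp [hX', hx, hx']
        rw [if_pos this]
        have := Finset.card_filter_le I' (G.Adj · x)
        omega
      · omega
    refine (Finset.sum_le_sum this).trans ?_
    rw [Finset.sum_add_distrib, Finset.sum_const, smul_eq_mul, ← Finset.sum_filter,
      Finset.sum_const, smul_eq_mul]
    have : (X.filter (· ∈ X')).card = X'.card := by congr 1; ext; simp [hX']
    rw [this, mul_comm X.card, mul_comm X'.card]
  rw [h1, hcard] at h2
  rw [hcard] at h3
  rcases Nat.eq_zero_or_pos s with rfl | hs
  · exact ⟨∅, ∅, by simp⟩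
  have h4 : X.card ≤ 2 * m * X'.card := by
    have : 2 * m * s * X.card ≤ m * (s * X.card + 2 * m * s * X'.card) :=
      h2.trans (Nat.mul_le_mul_left _ h3)
    have : (m * s) * X.card ≤ (m * s) * (2 * m * X'.card) := by nlinarith
    exact Nat.le_of_mul_le_mul_left this (Nat.mul_pos hm hs)
  have h5 : ∀ x ∈ X', ∃ J ⊆ I', J.card = s ∧ ∀ j ∈ J, G.Adj j x := by
    intro x hx
    obtain ⟨J, hJ, hJc⟩ := Finset.exists_subset_card_eq (Finset.mem_filter.mp hx).2
    exact ⟨J, fun j hj => (Finset.mem_filter.mp (hJ hj)).1, hJc,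
      fun j hj => (Finset.mem_filter.mp (hJ hj)).2⟩
  choose! f hf1 hf2 hf3 using h5
  have h6 : ∃ J ∈ I'.powerset, s ≤ (X'.filter fun x => f x = J).card := by
    apply Finset.exists_le_card_fiber_of_mul_le_card_of_maps_to
    · exact fun x hx => Finset.mem_powerset.mpr (hf1 x hx)
    · exact Finset.powerset_nonempty _
    · rw [Finset.card_powerset, hcard]
      have : 2 * m * s * 2 ^ (2 * m * s) ≤ 2 * m * X'.card := by omega
      have : (2 * m) * (2 ^ (2 * m * s) * s) ≤ 2 * m * X'.card := by nlinarith
      exact Nat.le_of_mul_le_mul_left this (by omega)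
  obtain ⟨J, -, hJ⟩ := h6
  obtain ⟨Z, hZ, hZc⟩ := Finset.exists_subset_card_eq hJ
  have hs' : Z.Nonempty := Finset.card_pos.mp (by omega)
  obtain ⟨z, hz⟩ := hs'
  have hz' := Finset.mem_filter.mp (hZ hz)
  refine ⟨J, Z, ?_, hZc, fun j hj z hz => ?_⟩
  · rw [← hz'.2]; exact hf2 z hz'.1
  · have hz' := Finset.mem_filter.mp (hZ hz)
    exact hf3 z hz'.1 j (hz'.2 ▸ hj)

/-! ## Edge counts -/

/-- The ordered pairs of adjacent vertices of `X`. -/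
noncomputable def adjPairs {V : Type*} (G : SimpleGraph V) (X : Finset V) : Finset (V × V) :=
  (X ×ˢ X).filter fun p => G.Adj p.1 p.2

lemma mem_adjPairs {V : Type*} {G : SimpleGraph V} {X : Finset V} {p : V × V} :
    p ∈ adjPairs G X ↔ p.1 ∈ X ∧ p.2 ∈ X ∧ G.Adj p.1 p.2 := by
  simp [adjPairs, and_assoc]

lemma card_adjPairs {V : Type*} (G : SimpleGraph V) (X : Finset V) :
    (adjPairs G X).card = ∑ v ∈ X, (X.filter (G.Adj v)).card := by
  simp only [adjPairs, Finset.card_filter, Finset.sum_product]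

lemma le_card_adjPairs {V : Type*} (G : SimpleGraph V) (X : Finset V) (k : ℕ)
    (h : ∀ v ∈ X, k ≤ (X.filter (G.Adj v)).card) : k * X.card ≤ (adjPairs G X).card := by
  rw [card_adjPairs, mul_comm, ← smul_eq_mul]
  exact Finset.card_nsmul_le_sum _ _ _ h

/-- Removing a vertex loses at most twice its degree from the number of adjacent pairs. -/
lemma card_adjPairs_le_erase {V : Type*} (G : SimpleGraph V) (X : Finset V) (v : V) :
    (adjPairs G X).card ≤ (adjPairs G (X.erase v)).card + 2 * (X.filter (G.Adj v)).card := by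
  have h : adjPairs G X ⊆ adjPairs G (X.erase v) ∪
      ((X.filter (G.Adj v)).image (fun u => (v, u)) ∪
        (X.filter (G.Adj v)).image (fun u => (u, v))) := by
    rintro ⟨a, b⟩ hab
    have := G.adj_comm a b
    simp only [mem_adjPairs, Finset.mem_union, Finset.mem_erase, Finset.mem_image,
      Finset.mem_filter, Prod.mk.injEq] at hab ⊢
    grind
  have h1 := Finset.card_le_card h
  have h2 := Finset.card_union_le (adjPairs G (X.erase v))
    ((X.filter (G.Adj v)).image (fun u => (v, u)) ∪ (X.filter (G.Adj v)).image (fun u => (u, v)))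
  have h3 := Finset.card_union_le ((X.filter (G.Adj v)).image (fun u => (v, u)))
    ((X.filter (G.Adj v)).image (fun u => (u, v)))
  have h4 := Finset.card_image_le (s := X.filter (G.Adj v)) (f := fun u => (v, u))
  have h5 := Finset.card_image_le (s := X.filter (G.Adj v)) (f := fun u => (u, v))
  omega

/-- A dense set contains a nonempty set of large minimum degree. -/
lemma exists_minDegree_subset {V : Type*} (G : SimpleGraph V) (k : ℕ) (X : Finset V)
    (h : 2 * k * X.card < (adjPairs G X).card) :
    ∃ X' ⊆ X, X'.Nonempty ∧ ∀ v ∈ X', k ≤ (X'.filter (G.Adj v)).card := by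
  induction X using Finset.strongInduction with
  | H X ih =>
    by_cases hX : ∀ v ∈ X, k ≤ (X.filter (G.Adj v)).card
    · refine ⟨X, subset_rfl, ?_, hX⟩
      rw [Finset.nonempty_iff_ne_empty]
      rintro rfl
      simp [adjPairs] at h
    · push Not at hX
      obtain ⟨v, hv, hlt⟩ := hX
      have h1 := card_adjPairs_le_erase G X v
      have h2 := Finset.card_erase_add_one hv
      obtain ⟨X', hX', h3⟩ := ih (X.erase v) (Finset.erase_ssubset hv) (by
        rw [← h2] at h
        nlinarith)
      exact ⟨X', hX'.trans (Finset.erase_subset _ _), h3⟩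

end Combinatorics

section Forests

open Classical

/-! ## Forests -/

/-- Every nonempty vertex set of a finite forest has a vertex with at most one neighbour
in the set. -/
lemma SimpleGraph.IsAcyclic.exists_unique_neighbor {V : Type*} {T : SimpleGraph V}
    (hT : T.IsAcyclic) {A : Finset V} (hA : A.Nonempty) :
    ∃ v ∈ A, ∀ u ∈ A, ∀ w ∈ A, T.Adj v u → T.Adj v w → u = w := by
  have hne : Nonempty (A : Set V) := hA.to_subtype
  obtain ⟨F, hF, -, hFt⟩ := (connected_top (V := (A : Set V))).exists_isTree_le_of_le_of_isAcyclic
    le_top (hT.induce (A : Set V))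
  rcases subsingleton_or_nontrivial (A : Set V) with hs | hs
  · obtain ⟨v, hv⟩ := hne
    refine ⟨v, hv, fun u hu w hw _ _ => ?_⟩
    exact congrArg Subtype.val (Subsingleton.elim (⟨u, hu⟩ : (A : Set V)) ⟨w, hw⟩)
  · obtain ⟨v, hv⟩ := hFt.exists_vert_degree_one_of_nontrivial
    refine ⟨v, v.2, fun u hu w hw h1 h2 => ?_⟩
    obtain ⟨x, -, hx⟩ := degree_eq_one_iff_existsUnique_adj.mp hv
    have e1 := hx ⟨u, hu⟩ (hF (by simpa using h1))
    have e2 := hx ⟨w, hw⟩ (hF (by simpa using h2))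
    exact congrArg Subtype.val (e1.trans e2.symm)

/-- Induction on the vertex sets of a forest, adding an isolated vertex or a leaf. -/
lemma SimpleGraph.IsAcyclic.finset_induction {V : Type*} {T : SimpleGraph V}
    (hT : T.IsAcyclic) {Q : Finset V → Prop} (empty : Q ∅)
    (isolated : ∀ A v, v ∉ A → (∀ u ∈ A, ¬ T.Adj v u) → Q A → Q (insert v A))
    (leaf : ∀ A v p, v ∉ A → p ∈ A → T.Adj v p → (∀ u ∈ A, T.Adj v u → u = p) → Q A →
      Q (insert v A)) (A : Finset V) : Q A := by
  induction A using Finset.strongInduction with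
  | H A ih =>
    rcases A.eq_empty_or_nonempty with rfl | hA
    · exact empty
    obtain ⟨v, hv, h⟩ := hT.exists_unique_neighbor hA
    have hQ := ih _ (Finset.erase_ssubset hv)
    rw [← Finset.insert_erase hv]
    by_cases hp : ∃ p ∈ A, T.Adj v p
    · obtain ⟨p, hp, hvp⟩ := hp
      exact leaf _ v p (by simp) (by simp [hvp.ne', hp]) hvp
        (fun u hu hu' => h u (Finset.mem_of_mem_erase hu) p hp hu' hvp) hQ
    · push Not at hp
      exact isolated _ v (by simp) (fun u hu => hp u (Finset.mem_of_mem_erase hu)) hQ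

/-- A graph of large minimum degree contains every small forest as a subgraph. -/
lemma SimpleGraph.IsAcyclic.exists_embedding_of_minDegree {V W : Type*} [Fintype V]
    {T : SimpleGraph V} (hT : T.IsAcyclic) (G : SimpleGraph W) (X : Finset W)
    (hX : X.Nonempty) (hdeg : ∀ x ∈ X, Fintype.card V ≤ (X.filter (G.Adj x)).card)
    (A : Finset V) : ∃ φ : V → W, (∀ a ∈ A, φ a ∈ X) ∧ Set.InjOn φ A ∧
      ∀ a ∈ A, ∀ b ∈ A, T.Adj a b → G.Adj (φ a) (φ b) := by
  obtain ⟨x0, hx0⟩ := hX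
  induction A using hT.finset_induction with
  | empty => exact ⟨fun _ => x0, by simp⟩
  | isolated A v hv hiso ih =>
    obtain ⟨φ, h1, h2, h3⟩ := ih
    have hlt : (A.image φ).card < X.card :=
      calc (A.image φ).card ≤ A.card := Finset.card_image_le
        _ < (insert v A).card := by rw [Finset.card_insert_of_notMem hv]; omega
        _ ≤ Fintype.card V := Finset.card_le_univ _
        _ ≤ _ := hdeg x0 hx0
        _ ≤ _ := Finset.card_filter_le _ _
    obtain ⟨z, hz, hz'⟩ := Finset.exists_mem_notMem_of_card_lt_card hlt
    have hne : ∀ a ∈ A, a ≠ v := fun a ha => by rintro rfl; exact hv ha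
    refine ⟨Function.update φ v z, ?_, ?_, ?_⟩
    · intro a ha
      by_cases hav : a = v <;> grind
    · intro a ha b hb hab
      simp only [Finset.coe_insert, Set.mem_insert_iff, Finset.mem_coe] at ha hb
      simp only [Function.update_apply] at hab
      have := @h2
      simp only [Set.InjOn, Finset.mem_coe] at this
      grind
    · intro a ha b hb hab
      have := hab.symm
      have := hab.ne
      simp only [Function.update_apply]
      grind
  | leaf A v p hv hp hvp hu ih =>
    obtain ⟨φ, h1, h2, h3⟩ := ih
    have hlt : (A.image φ).card < (X.filter (G.Adj (φ p))).card :=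
      calc (A.image φ).card ≤ A.card := Finset.card_image_le
        _ < (insert v A).card := by rw [Finset.card_insert_of_notMem hv]; omega
        _ ≤ Fintype.card V := Finset.card_le_univ _
        _ ≤ _ := hdeg _ (h1 p hp)
    obtain ⟨z, hz, hz'⟩ := Finset.exists_mem_notMem_of_card_lt_card hlt
    have hz2 := Finset.mem_filter.mp hz
    have hz3 := hz2.2.symm
    refine ⟨Function.update φ v z, ?_, ?_, ?_⟩
    · intro a ha
      by_cases hav : a = v <;> grind
    · intro a ha b hb hab
      simp only [Finset.coe_insert, Set.mem_insert_iff, Finset.mem_coe] at ha hb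
      simp only [Function.update_apply] at hab
      have := @h2
      simp only [Set.InjOn, Finset.mem_coe] at this
      grind
    · intro a ha b hb hab
      have := hab.symm
      have := hab.ne
      simp only [Function.update_apply]
      grind

/-- If no vertex of the image of `A` dominates a `1 / m` fraction of the large set `N`, then `N`
has a vertex outside of this image with no neighbour in it. -/
lemma exists_mem_not_adj {V W : Type*} (G : SimpleGraph W) (N : Finset W) (A : Finset V)
    (φ : V → W) (p : V → Prop) (m : ℕ) (hm : A.card < m) (hN : m * A.card < N.card)
    (h : ∀ a ∈ A, ¬ p a → m * (N.filter (G.Adj (φ a))).card < N.card) :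
    ∃ z ∈ N, z ∉ A.image φ ∧ ∀ a ∈ A, ¬ p a → ¬ G.Adj (φ a) z := by
  by_contra! hc
  have hsub : N ⊆ A.image φ ∪ (A.filter (¬ p ·)).biUnion fun a => N.filter (G.Adj (φ a)) := by
    intro z hz
    by_cases hz' : z ∈ A.image φ
    · exact Finset.mem_union_left _ hz'
    · obtain ⟨a, ha, hpa, haz⟩ := hc z hz hz'
      refine Finset.mem_union_right _ (Finset.mem_biUnion.mpr ⟨a, ?_, ?_⟩)
      · simp [ha, hpa]
      · simp [hz, haz]
  have h1 := (Finset.card_le_card hsub).trans (Finset.card_union_le _ _)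
  have h2 : (A.image φ).card ≤ A.card := Finset.card_image_le
  have h3 : m * ((A.filter (¬ p ·)).biUnion fun a => N.filter (G.Adj (φ a))).card ≤
      A.card * N.card := by
    calc _ ≤ m * ∑ a ∈ A.filter (¬ p ·), (N.filter (G.Adj (φ a))).card :=
          Nat.mul_le_mul_left _ Finset.card_biUnion_le
      _ = ∑ a ∈ A.filter (¬ p ·), m * (N.filter (G.Adj (φ a))).card := Finset.mul_sum _ _ _
      _ ≤ (A.filter (¬ p ·)).card * N.card := by
          rw [← smul_eq_mul]
          exact Finset.sum_le_card_nsmul _ _ _ fun a ha =>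
            (h a (Finset.mem_filter.mp ha).1 (Finset.mem_filter.mp ha).2).le
      _ ≤ _ := Nat.mul_le_mul_right _ (Finset.card_filter_le _ _)
  nlinarith

/-- A dense graph has a dense induced subgraph without arcs of a given digraph of bounded
out-degree. -/
lemma exists_dense_arc_free_subset {W : Type*} [Fintype W] (G : SimpleGraph W) (X : Finset W)
    (out : W → Finset W) (K d : ℕ) (hout : ∀ x ∈ X, (out x).card ≤ K)
    (hirr : ∀ x, x ∉ out x)
    (hX : (2 * K + 2 ^ (2 + 2 * K) * d) * X.card < (adjPairs G X).card) :
    ∃ X' ⊆ X, d * X'.card < (adjPairs G X').card ∧ ∀ x ∈ X', ∀ y ∈ X', y ∉ out x := by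
  set E := (adjPairs G X).filter fun p => p.2 ∉ out p.1 ∧ p.1 ∉ out p.2 with hE
  have h1 : (adjPairs G X).card ≤ E.card + 2 * K * X.card := by
    have hsub : adjPairs G X ⊆ E ∪ ((X.sigma out).image (fun q => (q.1, q.2)) ∪
        (X.sigma out).image (fun q => (q.2, q.1))) := by
      rintro ⟨a, b⟩ hab
      by_cases hab' : (a, b) ∈ E
      · exact Finset.mem_union_left _ hab'
      · apply Finset.mem_union_right
        simp only [hE, Finset.mem_filter, hab, true_and, not_and_or, not_not] at hab'
        rw [mem_adjPairs] at hab
        rcases hab' with h | h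
        · exact Finset.mem_union_left _ (Finset.mem_image.mpr ⟨⟨a, b⟩, by simp [hab.1, h], rfl⟩)
        · exact Finset.mem_union_right _
            (Finset.mem_image.mpr ⟨⟨b, a⟩, by simp [hab.2.1, h], rfl⟩)
    have h2 := Finset.card_le_card hsub
    have h3 := Finset.card_union_le E ((X.sigma out).image (fun q => (q.1, q.2)) ∪
        (X.sigma out).image (fun q => (q.2, q.1)))
    have h4 := Finset.card_union_le ((X.sigma out).image (fun q => (q.1, q.2)))
        ((X.sigma out).image (fun q => (q.2, q.1)))
    have h5 := Finset.card_image_le (s := X.sigma out) (f := fun q => (q.1, q.2))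
    have h6 := Finset.card_image_le (s := X.sigma out) (f := fun q => (q.2, q.1))
    have h7 : (X.sigma out).card ≤ X.card * K := by
      rw [Finset.card_sigma, ← smul_eq_mul]
      exact Finset.sum_le_card_nsmul _ _ _ hout
    nlinarith
  obtain ⟨S, hS⟩ := exists_sample E (fun p => {p.1, p.2}) (fun p => out p.1 ∪ out p.2)
    (2 + 2 * K) (by
      rintro ⟨a, b⟩ hab
      simp only [hE, Finset.mem_filter] at hab
      rw [Finset.disjoint_left]
      intro x hx hx'
      simp only [Finset.mem_insert, Finset.mem_singleton, Finset.mem_union] at hx hx'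
      grind) (by
      rintro ⟨a, b⟩ hab
      have hab := (mem_adjPairs.mp (Finset.mem_filter.mp hab).1)
      have h2 := hout a hab.1
      have h3 := hout b hab.2.1
      have h4 := Finset.card_union_le (out a) (out b)
      have h5 := Finset.card_le_two (a := a) (b := b)
      simp only
      omega)
  set X' := X.filter fun x => x ∈ S ∧ Disjoint (out x) S with hX'
  refine ⟨X', Finset.filter_subset _ _, ?_, ?_⟩
  · have h2 : (E.filter fun p => ({p.1, p.2} : Finset W) ⊆ S ∧
        Disjoint (out p.1 ∪ out p.2) S) ⊆ adjPairs G X' := by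
      rintro ⟨a, b⟩ hab
      simp only [hE, hX', mem_adjPairs, Finset.mem_filter, Finset.disjoint_union_left,
        Finset.insert_subset_iff, Finset.singleton_subset_iff] at hab ⊢
      tauto
    have h3 := Finset.card_le_card h2
    have h4 : X'.card ≤ X.card := Finset.card_filter_le _ _
    have h5 : 2 ^ (2 + 2 * K) * (d * X.card) < 2 ^ (2 + 2 * K) * (adjPairs G X').card := by
      have := Nat.mul_le_mul_left (2 ^ (2 + 2 * K)) h3
      nlinarith
    have h6 := Nat.lt_of_mul_lt_mul_left h5
    nlinarith
  · intro x hx y hy hxy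
    simp only [hX', Finset.mem_filter] at hx hy
    exact Finset.disjoint_left.mp hx.2.2 hxy hy.2.1

end Forests

section Degeneracy

open Classical

/-! ## Induced forests in dense graphs without a biclique -/

/-- `φ` maps `A` into `X` and is an isomorphism from `T[A]` to its image. -/
def EmbedsOn {V W : Type*} (T : SimpleGraph V) (G : SimpleGraph W) (A : Finset V) (X : Finset W)
    (φ : V → W) : Prop :=
  (∀ a ∈ A, φ a ∈ X) ∧ Set.InjOn φ A ∧ ∀ a ∈ A, ∀ b ∈ A, T.Adj a b ↔ G.Adj (φ a) (φ b)

lemma EmbedsOn.update {V W : Type*} {T : SimpleGraph V} {G : SimpleGraph W} {A : Finset V}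
    {X Y : Finset W} {φ : V → W} (h : EmbedsOn T G A X φ) (hXY : X ⊆ Y) {v : V} (hv : v ∉ A)
    {z : W} (hz : z ∈ Y) (hz' : z ∉ A.image φ) (hadj : ∀ a ∈ A, T.Adj v a ↔ G.Adj (φ a) z) :
    EmbedsOn T G (insert v A) Y (Function.update φ v z) := by
  obtain ⟨h1, h2, h3⟩ := h
  have hT := T.adj_comm
  have hG := G.adj_comm
  have hTi := fun x => T.irrefl (v := x)
  have hGi := fun x => G.irrefl (v := x)
  simp only [Set.InjOn, Finset.mem_coe] at h2
  refine ⟨?_, ?_, ?_⟩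
  · intro a ha
    by_cases hav : a = v <;> grind
  · intro a ha b hb hab
    simp only [Finset.coe_insert, Set.mem_insert_iff, Finset.mem_coe] at ha hb
    simp only [Function.update_apply] at hab
    grind
  · intro a ha b hb
    simp only [Function.update_apply]
    grind

/-- Every forest is an induced subgraph of every sufficiently dense graph without `K_{s,s}`. -/
lemma SimpleGraph.IsAcyclic.exists_embedsOn_of_dense {V : Type*} {T : SimpleGraph V}
    (hT : T.IsAcyclic) (s : ℕ) (A : Finset V) :
    ∃ d : ℕ, ∀ {W : Type} [Fintype W] (G : SimpleGraph W), BicliqueFree G s →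
      ∀ X : Finset W, d * X.card < (adjPairs G X).card → ∃ φ : V → W, EmbedsOn T G A X φ := by
  induction A using hT.finset_induction with
  | empty =>
    refine ⟨0, fun {W} _ G _ X hX => ?_⟩
    obtain ⟨p, hp⟩ := Finset.card_pos.mp (by omega : 0 < (adjPairs G X).card)
    exact ⟨fun _ => p.1, by simp [EmbedsOn]⟩
  | isolated A v hv hiso ih =>
    obtain ⟨d, hd⟩ := ih
    obtain ⟨K, N, hKN⟩ := BicliqueFree.card_heavy_lt s (A.card + 1) (Nat.succ_pos _)
    set δ := (A.card + 1) * A.card + 1 + N + d + 1 + 2 * K with hδ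
    refine ⟨2 * δ, fun {W} _ G hG X hX => ?_⟩
    obtain ⟨X', hX', hne, hdeg⟩ := exists_minDegree_subset G δ X hX
    have hXc : δ ≤ X'.card := by
      obtain ⟨x, hx⟩ := hne
      exact (hdeg x hx).trans (Finset.card_filter_le _ _)
    set I := X'.filter fun y => X'.card ≤ (A.card + 1) * (X'.filter (G.Adj y)).card with hI
    have hIc : I.card < K := hKN G hG X' I (by omega) fun i hi => (Finset.mem_filter.mp hi).2
    have hpairs := le_card_adjPairs G X' δ hdeg
    have hsub : (adjPairs G X').card ≤ (adjPairs G (X' \ I)).card + 2 * (I.card * X'.card) := by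
      have hsub : adjPairs G X' ⊆ adjPairs G (X' \ I) ∪ (I ×ˢ X' ∪ X' ×ˢ I) := by
        rintro ⟨a, b⟩ hab
        simp only [mem_adjPairs, Finset.mem_union, Finset.mem_sdiff, Finset.mem_product] at hab ⊢
        tauto
      have h1 := (Finset.card_le_card hsub).trans (Finset.card_union_le _ _)
      have h2 := Finset.card_union_le (I ×ˢ X') (X' ×ˢ I)
      rw [Finset.card_product, Finset.card_product] at h2
      nlinarith
    have hdense : d * (X' \ I).card < (adjPairs G (X' \ I)).card := by
      have h1 : (X' \ I).card ≤ X'.card := Finset.card_le_card Finset.sdiff_subset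
      have h2 := Nat.mul_le_mul_right X'.card hIc.le
      have h3 := Nat.mul_le_mul_left d h1
      have h4 : 0 < X'.card := by omega
      rw [hδ] at hpairs
      nlinarith [Nat.zero_le (((A.card + 1) * A.card + 1 + N) * X'.card)]
    obtain ⟨φ, hφ⟩ := hd G hG _ hdense
    obtain ⟨z, hz, hz', hzadj⟩ := exists_mem_not_adj G X' A φ (fun _ => False) (A.card + 1)
      (Nat.lt_succ_self _) (by omega) (by
        intro a ha _
        have h1 := hφ.1 a ha
        by_contra! hc
        simp only [hI, Finset.mem_sdiff, Finset.mem_filter, not_and] at h1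
        exact h1.2 h1.1 hc)
    exact ⟨_, hφ.update (Finset.sdiff_subset.trans hX') hv (hX' hz) hz' fun a ha =>
      iff_of_false (hiso a ha) (hzadj a ha not_false)⟩
  | leaf A v p hv hp hvp huniq ih =>
    obtain ⟨d, hd⟩ := ih
    obtain ⟨K, N, hKN⟩ := BicliqueFree.card_heavy_lt s (A.card + 1) (Nat.succ_pos _)
    set δ := (A.card + 1) * A.card + 1 + N + (2 * K + 2 ^ (2 + 2 * K) * d) + 1 with hδ
    refine ⟨2 * δ, fun {W} _ G hG X hX => ?_⟩
    obtain ⟨X', hX', hne, hdeg⟩ := exists_minDegree_subset G δ X hX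
    have hpairs := le_card_adjPairs G X' δ hdeg
    let N' : W → Finset W := fun x => X'.filter (G.Adj x)
    let out : W → Finset W := fun x => X'.filter fun y => y ≠ x ∧
      (N' x).card ≤ (A.card + 1) * ((N' x).filter (G.Adj y)).card
    have hout : ∀ x ∈ X', (out x).card ≤ K := fun x hx =>
      (hKN G hG (N' x) (out x) (by have := hdeg x hx; simp only [N']; omega)
        fun i hi => (Finset.mem_filter.mp hi).2.2).le
    obtain ⟨X'', hX'', hdense, harc⟩ := exists_dense_arc_free_subset G X' out K d hout
      (by simp [out]) (by
        have h4 : 0 < X'.card := Finset.card_pos.mpr hne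
        refine lt_of_lt_of_le ?_ hpairs
        exact Nat.mul_lt_mul_of_pos_right (by omega) h4)
    obtain ⟨φ, hφ⟩ := hd G hG _ hdense
    have hpX := hX'' (hφ.1 p hp)
    obtain ⟨z, hz, hz', hzadj⟩ := exists_mem_not_adj G (N' (φ p)) A φ (· = p) (A.card + 1)
      (Nat.lt_succ_self _) (by have := hdeg _ hpX; simp only [N']; omega) (by
        intro a ha hap
        by_contra! hc
        refine harc _ (hφ.1 p hp) _ (hφ.1 a ha) (Finset.mem_filter.mpr ⟨hX'' (hφ.1 a ha), ?_, hc⟩)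
        exact fun he => hap (hφ.2.1 ha hp he))
    have hz2 := Finset.mem_filter.mp hz
    refine ⟨_, hφ.update (hX''.trans hX') hv (hX' hz2.1) hz' fun a ha => ?_⟩
    by_cases hap : a = p
    · subst hap
      exact iff_of_true hvp hz2.2
    · exact iff_of_false (fun h => hap (huniq a ha h)) (hzadj a ha hap)

/-! ## Degenerate graphs -/

/-- Degenerate graphs have orientations of bounded out-degree. -/
lemma exists_orientation {V : Type*} [Fintype V] (G : SimpleGraph V) (k : ℕ)
    (h : ∀ X : Finset V, X.Nonempty → ∃ v ∈ X, (X.filter (G.Adj v)).card ≤ k) :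
    ∃ out : V → Finset V, (∀ v, (out v).card ≤ k) ∧ (∀ v, ∀ u ∈ out v, G.Adj v u) ∧
      ∀ u v, G.Adj u v → u ∈ out v ∨ v ∈ out u := by
  suffices ∀ X : Finset V, ∃ out : V → Finset V, (∀ v, (out v).card ≤ k) ∧
      (∀ v, ∀ u ∈ out v, G.Adj v u ∧ u ∈ X ∧ v ∈ X) ∧
      ∀ u ∈ X, ∀ v ∈ X, G.Adj u v → u ∈ out v ∨ v ∈ out u by
    obtain ⟨out, h1, h2, h3⟩ := this Finset.univ
    exact ⟨out, h1, fun v u hu => (h2 v u hu).1,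
      fun u v => h3 u (Finset.mem_univ u) v (Finset.mem_univ v)⟩
  intro X
  induction X using Finset.strongInduction with
  | H X ih =>
    rcases X.eq_empty_or_nonempty with rfl | hX
    · exact ⟨fun _ => ∅, by simp⟩
    obtain ⟨v, hv, hk⟩ := h X hX
    obtain ⟨out, h1, h2, h3⟩ := ih _ (Finset.erase_ssubset hv)
    have hG := G.adj_comm
    have hGi := fun x => G.irrefl (v := x)
    refine ⟨Function.update out v (X.filter (G.Adj v)), ?_, ?_, ?_⟩ <;>
    · simp only [Function.update_apply]
      grind

/-- Degenerate graphs have bounded chromatic number. -/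
lemma colorable_of_degenerate {V : Type*} [Fintype V] (G : SimpleGraph V) (k : ℕ)
    (h : ∀ X : Finset V, X.Nonempty → ∃ v ∈ X, (X.filter (G.Adj v)).card ≤ k) :
    ∃ c : V → Fin (k + 1), ∀ u v, G.Adj u v → c u ≠ c v := by
  suffices ∀ X : Finset V, ∃ c : V → Fin (k + 1), ∀ u ∈ X, ∀ v ∈ X, G.Adj u v → c u ≠ c v by
    obtain ⟨c, hc⟩ := this Finset.univ
    exact ⟨c, fun u v => hc u (Finset.mem_univ u) v (Finset.mem_univ v)⟩
  intro X
  induction X using Finset.strongInduction with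
  | H X ih =>
    rcases X.eq_empty_or_nonempty with rfl | hX
    · exact ⟨fun _ => 0, by simp⟩
    obtain ⟨v, hv, hk⟩ := h X hX
    obtain ⟨c, hc⟩ := ih _ (Finset.erase_ssubset hv)
    obtain ⟨z, -, hz⟩ := Finset.exists_mem_notMem_of_card_lt_card
      (s := (X.filter (G.Adj v)).image c) (t := Finset.univ) (by
        have := Finset.card_image_le (s := X.filter (G.Adj v)) (f := c)
        rw [Finset.card_univ, Fintype.card_fin]
        omega)
    have hG := G.adj_comm
    have hGi := fun x => G.irrefl (v := x)
    refine ⟨Function.update c v z, ?_⟩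
    simp only [Function.update_apply]
    grind

end Degeneracy

section Fraternal

open Classical

/-! ## Star colorings from orientations -/

/-- The incidence graph of all vertices and unordered pairs (including loops) of `V`. -/
def incGraph (V : Type*) : SimpleGraph (V ⊕ Sym2 V) where
  Adj
    | Sum.inl x, Sum.inr e => x ∈ e
    | Sum.inr e, Sum.inl x => x ∈ e
    | _, _ => False
  symm := ⟨by rintro (x | e) (y | f) <;> simp⟩
  loopless := ⟨by rintro (x | e) <;> simp⟩

/-- Two vertices conflict if they are adjacent, or have a common neighbour `v` that is not the
sink of both edges. -/
def conflictGraph {W : Type*} (G : SimpleGraph W) (out : W → Finset W) : SimpleGraph W where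
  Adj u w := u ≠ w ∧ (G.Adj u w ∨ ∃ v, G.Adj u v ∧ G.Adj v w ∧ (u ∈ out v ∨ w ∈ out v))
  symm := ⟨by
    rintro u w ⟨h, h'⟩
    refine ⟨h.symm, h'.imp (·.symm) ?_⟩
    rintro ⟨v, h1, h2, h3⟩
    exact ⟨v, h2.symm, h1.symm, h3.symm⟩⟩
  loopless := ⟨fun u h => h.1 rfl⟩

/-- A proper coloring of the conflict graph is a star coloring. -/
lemma isStarColoring_of_conflictGraph {W α : Type*} {G : SimpleGraph W} {out : W → Finset W}
    (hout : ∀ u v, G.Adj u v → u ∈ out v ∨ v ∈ out u)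
    {c : W → α} (hc : ∀ u v, (conflictGraph G out).Adj u v → c u ≠ c v) :
    IsStarColoring G c := by
  refine ⟨fun u v h => hc u v ⟨h.ne, Or.inl h⟩, ?_⟩
  rintro x y z w hxy hyz hzw hxz hyw - ⟨h1, h2⟩
  have h3 : z ∉ out y := fun h => hc x z ⟨hxz, Or.inr ⟨y, hxy, hyz, Or.inr h⟩⟩ h1
  have h4 : y ∉ out z := fun h => hc y w ⟨hyw, Or.inr ⟨z, hyz, hzw, Or.inl h⟩⟩ h2
  rcases hout y z hyz with h | h
  · exact h4 h
  · exact h3 h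

/-- The nonadjacent ordered pairs of distinct vertices of `X` with a common in-neighbour. -/
noncomputable def fraternalPairs {W : Type*} (G : SimpleGraph W) (out : W → Finset W)
    (X : Finset W) : Finset (W × W) :=
  (X ×ˢ X).filter fun p => p.1 ≠ p.2 ∧ ¬ G.Adj p.1 p.2 ∧ ∃ v, p.1 ∈ out v ∧ p.2 ∈ out v

lemma mem_fraternalPairs {W : Type*} {G : SimpleGraph W} {out : W → Finset W} {X : Finset W}
    {p : W × W} : p ∈ fraternalPairs G out X ↔ p.1 ∈ X ∧ p.2 ∈ X ∧ p.1 ≠ p.2 ∧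
      ¬ G.Adj p.1 p.2 ∧ ∃ v, p.1 ∈ out v ∧ p.2 ∈ out v := by
  simp [fraternalPairs, and_assoc]

lemma card_adjPairs_conflictGraph_le {W : Type*} (G : SimpleGraph W) (out : W → Finset W)
    (k : ℕ) (hk : ∀ v, (out v).card ≤ k)
    (hout : ∀ u v, G.Adj u v → u ∈ out v ∨ v ∈ out u) (X : Finset W) :
    (adjPairs (conflictGraph G out) X).card ≤
      2 * (k + k * k) * X.card + (fraternalPairs G out X).card := by
  let R : W → Finset W := fun u => out u ∪ (out u).biUnion out
  have hR : ∀ u ∈ X, (R u).card ≤ k + k * k := by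
    intro u _
    refine (Finset.card_union_le _ _).trans (Nat.add_le_add (hk u) ?_)
    refine Finset.card_biUnion_le.trans ?_
    refine (Finset.sum_le_card_nsmul _ _ k fun v _ => hk v).trans ?_
    rw [smul_eq_mul]
    exact Nat.mul_le_mul_right _ (hk u)
  have hsub : adjPairs (conflictGraph G out) X ⊆ ((X.sigma R).image (fun q => (q.1, q.2)) ∪
      (X.sigma R).image (fun q => (q.2, q.1))) ∪ fraternalPairs G out X := by
    rintro ⟨u, w⟩ h
    obtain ⟨hu, hw, hne, h⟩ := mem_adjPairs.mp h
    simp only at hu hw hne h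
    have key : w ∈ R u ∨ u ∈ R w ∨ (u, w) ∈ fraternalPairs G out X := by
      simp only [R, mem_fraternalPairs, Finset.mem_union, Finset.mem_biUnion]
      by_cases hadj : G.Adj u w
      · rcases hout u w hadj with h | h <;> tauto
      · obtain ⟨v, h1, h2, h3⟩ := h.resolve_left hadj
        rcases hout u v h1 with h4 | h4 <;> rcases hout v w h2 with h5 | h5 <;> grind
    rcases key with h | h | h
    · exact Finset.mem_union_left _ (Finset.mem_union_left _
        (Finset.mem_image.mpr ⟨⟨u, w⟩, by simp [hu, h], rfl⟩))
    · exact Finset.mem_union_left _ (Finset.mem_union_right _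
        (Finset.mem_image.mpr ⟨⟨w, u⟩, by simp [hw, h], rfl⟩))
    · exact Finset.mem_union_right _ h
  have h1 := (Finset.card_le_card hsub).trans (Finset.card_union_le _ _)
  have h2 := Finset.card_union_le ((X.sigma R).image (fun q => (q.1, q.2)))
      ((X.sigma R).image (fun q => (q.2, q.1)))
  have h3 := Finset.card_image_le (s := X.sigma R) (f := fun q => (q.1, q.2))
  have h4 := Finset.card_image_le (s := X.sigma R) (f := fun q => (q.2, q.1))
  have h5 : (X.sigma R).card ≤ X.card * (k + k * k) := by
    rw [Finset.card_sigma, ← smul_eq_mul]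
    exact Finset.sum_le_card_nsmul _ _ _ hR
  nlinarith

set_option maxHeartbeats 1000000 in
/-- A set with many fraternal pairs contains the branch vertices `U` of an induced
`1`-subdivision of a dense graph: the centers `C` and `U` are independent, and `c ∈ C` is
adjacent in `U` precisely to `a c` and `b c`. -/
lemma exists_dense_subdivision {W : Type*} [Fintype W] (G : SimpleGraph W) (out : W → Finset W)
    (k m : ℕ) (hk : ∀ v, (out v).card ≤ k) (hadj : ∀ v, ∀ u ∈ out v, G.Adj v u)
    (hout : ∀ u v, G.Adj u v → u ∈ out v ∨ v ∈ out u) (X : Finset W)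
    (hX : k * k * (2 ^ (4 * k + 4) * (k + m)) * X.card < (fraternalPairs G out X).card) :
    ∃ (U C : Finset W) (a b : W → W), m * U.card < C.card ∧
      (∀ u ∈ U, ∀ v ∈ U, ¬ G.Adj u v) ∧ (∀ c ∈ C, ∀ d ∈ C, ¬ G.Adj c d) ∧ Disjoint U C ∧
      (∀ c ∈ C, a c ∈ U ∧ b c ∈ U ∧ a c ≠ b c) ∧
      (∀ c ∈ C, ∀ d ∈ C, a c = a d → b c = b d → c = d) ∧
      ∀ c ∈ C, ∀ u ∈ U, G.Adj u c ↔ u = a c ∨ u = b c := by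
  have hGi := fun x => G.irrefl (v := x)
  have hG := G.adj_comm
  have hcen : ∀ p ∈ fraternalPairs G out X, ∃ v, p.1 ∈ out v ∧ p.2 ∈ out v :=
    fun p hp => (mem_fraternalPairs.mp hp).2.2.2.2
  obtain ⟨p₀, -⟩ := Finset.card_pos.mp ((Nat.zero_le _).trans_lt hX)
  have : Nonempty W := ⟨p₀.1⟩
  choose! cen hcen using hcen
  set C0 := (fraternalPairs G out X).image cen with hC0
  have h1 : (fraternalPairs G out X).card ≤ k * k * C0.card := by
    refine Finset.card_le_mul_card_image _ _ fun v _ => ?_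
    calc _ ≤ (out v ×ˢ out v).card := Finset.card_le_card fun p hp => by
            rw [Finset.mem_filter] at hp
            exact Finset.mem_product.mpr (hp.2 ▸ hcen p hp.1)
      _ ≤ k * k := by rw [Finset.card_product]; exact Nat.mul_le_mul (hk v) (hk v)
  have hends : ∀ c ∈ C0, ∃ p ∈ fraternalPairs G out X, cen p = c :=
    fun c hc => Finset.mem_image.mp hc
  choose! e he hce using hends
  have hprop : ∀ c ∈ C0, (e c).1 ∈ out c ∧ (e c).2 ∈ out c ∧ (e c).1 ∈ X ∧ (e c).2 ∈ X ∧
      (e c).1 ≠ (e c).2 ∧ ¬ G.Adj (e c).1 (e c).2 := by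
    intro c hc
    have h2 := hcen _ (he c hc)
    rw [hce c hc] at h2
    have h3 := mem_fraternalPairs.mp (he c hc)
    exact ⟨h2.1, h2.2, h3.1, h3.2.1, h3.2.2.1, h3.2.2.2.1⟩
  let BL : W → Finset W := fun c => (out (e c).1 ∪ out (e c).2) ∪
    ((out c \ {(e c).1, (e c).2}) ∪ {c})
  obtain ⟨S, hS⟩ := exists_sample (Ω := W ⊕ W) C0
    (fun c => {Sum.inl (e c).1, Sum.inl (e c).2, Sum.inr c})
    (fun c => (BL c).disjSum (out c)) (4 * k + 4)
    (by
      intro c hc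
      have h2 := hprop c hc
      have h3 := hadj c
      have h4 := hadj (e c).1
      have h5 := hadj (e c).2
      rw [Finset.disjoint_left]
      intro x hx
      simp only [Finset.mem_insert, Finset.mem_singleton] at hx
      rcases hx with rfl | rfl | rfl <;>
        simp only [BL, Finset.inl_mem_disjSum, Finset.inr_mem_disjSum, Finset.mem_union,
          Finset.mem_sdiff, Finset.mem_insert, Finset.mem_singleton] <;> grind)
    (by
      intro c hc
      have h2 := Finset.card_le_three (a := (Sum.inl (e c).1 : W ⊕ W)) (b := Sum.inl (e c).2)
        (c := Sum.inr c)
      have h3 := hk c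
      have h4 := hk (e c).1
      have h5 := hk (e c).2
      have h6 : (BL c).card ≤ ((out (e c).1).card + (out (e c).2).card) + ((out c).card + 1) := by
        refine (Finset.card_union_le _ _).trans (Nat.add_le_add (Finset.card_union_le _ _) ?_)
        refine (Finset.card_union_le _ _).trans (Nat.add_le_add ?_ (by simp))
        exact Finset.card_le_card Finset.sdiff_subset
      rw [Finset.card_disjSum]
      omega)
  set C1 := C0.filter fun c => ({Sum.inl (e c).1, Sum.inl (e c).2, Sum.inr c} : Finset (W ⊕ W)) ⊆ S
    ∧ Disjoint ((BL c).disjSum (out c)) S with hC1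
  replace hS : C0.card ≤ 2 ^ (4 * k + 4) * C1.card := by convert hS
  have hC1p : ∀ c ∈ C1, c ∈ C0 ∧ Sum.inl (e c).1 ∈ S ∧ Sum.inl (e c).2 ∈ S ∧ Sum.inr c ∈ S ∧
      (∀ x ∈ BL c, Sum.inl x ∉ S) ∧ ∀ x ∈ out c, Sum.inr x ∉ S := by
    intro c hc
    obtain ⟨h2, h3, h4⟩ := Finset.mem_filter.mp hc
    simp only [Finset.insert_subset_iff, Finset.singleton_subset_iff] at h3
    rw [Finset.disjoint_left] at h4
    exact ⟨h2, h3.1, h3.2.1, h3.2.2, fun x hx => h4 (Finset.inl_mem_disjSum.mpr hx),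
      fun x hx => h4 (Finset.inr_mem_disjSum.mpr hx)⟩
  set U := X.filter fun x => Sum.inl x ∈ S ∧ ∀ y ∈ out x, Sum.inl y ∉ S with hU
  set C2 := C1 \ U.biUnion out with hC2
  have hUX : U.card ≤ X.card := Finset.card_filter_le _ _
  have hbad : C1.card ≤ C2.card + k * X.card := by
    have h2 : C1.card ≤ C2.card + (U.biUnion out).card := by
      rw [hC2]
      have := Finset.le_card_sdiff (U.biUnion out) C1
      omega
    have h3 : (U.biUnion out).card ≤ U.card * k := by
      refine Finset.card_biUnion_le.trans ?_
      rw [← smul_eq_mul]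
      exact Finset.sum_le_card_nsmul _ _ _ fun v _ => hk v
    nlinarith
  refine ⟨U, C2, fun c => (e c).1, fun c => (e c).2, ?_, ?_, ?_, ?_, ?_, ?_, ?_⟩
  · have h2 : (fraternalPairs G out X).card ≤ k * k * 2 ^ (4 * k + 4) * (C2.card + k * X.card) :=
      calc _ ≤ k * k * C0.card := h1
        _ ≤ k * k * (2 ^ (4 * k + 4) * C1.card) := Nat.mul_le_mul_left _ hS
        _ = k * k * 2 ^ (4 * k + 4) * C1.card := by ring
        _ ≤ _ := Nat.mul_le_mul_left _ hbad
    have h3 : k * k * 2 ^ (4 * k + 4) * ((k + m) * X.card) <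
        k * k * 2 ^ (4 * k + 4) * (C2.card + k * X.card) :=
      lt_of_eq_of_lt (by ring) (hX.trans_le h2)
    have h4 := Nat.lt_of_mul_lt_mul_left h3
    nlinarith
  · intro u hu v hv huv
    have hu := Finset.mem_filter.mp hu
    have hv := Finset.mem_filter.mp hv
    rcases hout u v huv with h | h
    · exact hv.2.2 u h hu.2.1
    · exact hu.2.2 v h hv.2.1
  · intro c hc d hd hcd
    have hc := hC1p c (Finset.mem_sdiff.mp hc).1
    have hd := hC1p d (Finset.mem_sdiff.mp hd).1
    rcases hout c d hcd with h | h
    · exact hd.2.2.2.2.2 c h hc.2.2.2.1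
    · exact hc.2.2.2.2.2 d h hd.2.2.2.1
  · rw [Finset.disjoint_left]
    intro c hc hc'
    have hc' := hC1p c (Finset.mem_sdiff.mp hc').1
    exact hc'.2.2.2.2.1 c (by simp [BL]) (Finset.mem_filter.mp hc).2.1
  · intro c hc
    have hc := hC1p c (Finset.mem_sdiff.mp hc).1
    have h2 := hprop c hc.1
    refine ⟨Finset.mem_filter.mpr ⟨h2.2.2.1, hc.2.1, fun y hy => ?_⟩,
      Finset.mem_filter.mpr ⟨h2.2.2.2.1, hc.2.2.1, fun y hy => ?_⟩, h2.2.2.2.2.1⟩ <;>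
    exact hc.2.2.2.2.1 y (by simp [BL, hy])
  · intro c hc d hd h2 h3
    have hc := hC1p c (Finset.mem_sdiff.mp hc).1
    have hd := hC1p d (Finset.mem_sdiff.mp hd).1
    rw [← hce c hc.1, ← hce d hd.1, Prod.ext h2 h3]
  · intro c hc u hu
    have hc' := Finset.mem_sdiff.mp hc
    have hc1 := hC1p c hc'.1
    have h2 := hprop c hc1.1
    constructor
    · intro huc
      rcases hout u c huc with h | h
      · by_contra hne
        refine hc1.2.2.2.2.1 u ?_ (Finset.mem_filter.mp hu).2.1
        simp only [BL, Finset.mem_union, Finset.mem_sdiff, Finset.mem_insert,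
          Finset.mem_singleton]
        tauto
      · exact absurd (Finset.mem_biUnion.mpr ⟨u, hu, h⟩) hc'.2
    · rintro (rfl | rfl)
      · exact (hadj c _ h2.1).symm
      · exact (hadj c _ h2.2.1).symm

/-- If a forest `T` is an induced subgraph of the `1`-subdivision of a forest `F`, then it is an
induced subgraph of every graph as in `exists_dense_subdivision`. -/
lemma exists_embedding_of_dense_subdivision {V W : Type*} [Fintype V] {T F : SimpleGraph V}
    (hF : F.IsAcyclic) (g : T ↪g incGraph V) (hg : ∀ v e, g v = Sum.inr e → e ∈ F.edgeSet)
    (G : SimpleGraph W) (U C : Finset W) (a b : W → W)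
    (hcard : 2 * Fintype.card V * U.card < C.card)
    (hU : ∀ u ∈ U, ∀ v ∈ U, ¬ G.Adj u v) (hC : ∀ c ∈ C, ∀ d ∈ C, ¬ G.Adj c d)
    (hUC : Disjoint U C) (hab : ∀ c ∈ C, a c ∈ U ∧ b c ∈ U ∧ a c ≠ b c)
    (hinj : ∀ c ∈ C, ∀ d ∈ C, a c = a d → b c = b d → c = d)
    (hUCadj : ∀ c ∈ C, ∀ u ∈ U, G.Adj u c ↔ u = a c ∨ u = b c) :
    IsInducedSubgraphOf T G := by
  let F' : SimpleGraph W := SimpleGraph.fromEdgeSet {e | ∃ c ∈ C, e = s(a c, b c)}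
  have hF' : C.card ≤ (adjPairs F' U).card := by
    refine Finset.card_le_card_of_injOn (fun c => (a c, b c)) (fun c hc => ?_) ?_
    · refine mem_adjPairs.mpr ⟨(hab c hc).1, (hab c hc).2.1, ?_⟩
      exact (fromEdgeSet_adj _).mpr ⟨⟨c, hc, rfl⟩, (hab c hc).2.2⟩
    · intro c hc d hd h
      exact hinj c hc d hd (congrArg Prod.fst h) (congrArg Prod.snd h)
  obtain ⟨U', hU', hne, hdeg⟩ := exists_minDegree_subset F' (Fintype.card V) U
    (hcard.trans_le hF')
  obtain ⟨φ, hφ, hφi, hφa⟩ := hF.exists_embedding_of_minDegree F' U' hne hdeg Finset.univ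
  have hφU : ∀ x, φ x ∈ U := fun x => hU' (hφ x (Finset.mem_univ x))
  have hφi : Function.Injective φ := fun x y h => hφi (by simp) (by simp) h
  have hκ : ∀ e ∈ F.edgeSet, ∃ c ∈ C, e.map φ = s(a c, b c) := by
    intro e
    induction e with
    | h x y =>
      intro he
      exact ((fromEdgeSet_adj _).mp (hφa x (Finset.mem_univ x) y (Finset.mem_univ y) he)).1
  have : Nonempty W := ⟨hne.choose⟩
  choose! κ hκC hκ using hκ
  let ψ : V ⊕ Sym2 V → W := Sum.elim φ κ
  have hmem : ∀ x, ∀ e ∈ F.edgeSet, G.Adj (φ x) (κ e) ↔ x ∈ e := by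
    intro x e he
    rw [hUCadj _ (hκC e he) _ (hφU x), ← Sym2.mem_iff, ← hκ e he, Sym2.mem_map]
    constructor
    · rintro ⟨y, hy, hxy⟩
      exact hφi hxy ▸ hy
    · exact fun hx => ⟨x, hx, rfl⟩
  have hdisj : ∀ x, ∀ e ∈ F.edgeSet, φ x ≠ κ e := fun x e he h =>
    Finset.disjoint_left.mp hUC (hφU x) (h ▸ hκC e he)
  refine ⟨⟨⟨fun v => ψ (g v), ?_⟩, ?_⟩⟩
  · intro u v huv
    apply g.injective
    rcases hu : g u with x | e <;> rcases hv : g v with y | f <;>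
      simp only [hu, hv, ψ, Sum.elim_inl, Sum.elim_inr] at huv
    · rw [hφi huv]
    · exact absurd huv (hdisj _ _ (hg _ _ hv))
    · exact absurd huv.symm (hdisj _ _ (hg _ _ hu))
    · have := hκ e (hg _ _ hu)
      rw [huv, ← hκ f (hg _ _ hv)] at this
      rw [Sym2.map.injective hφi this]
  · intro u v
    rw [← g.map_adj_iff]
    change G.Adj (ψ (g u)) (ψ (g v)) ↔ (incGraph V).Adj (g u) (g v)
    rcases hu : g u with x | e <;> rcases hv : g v with y | f <;>
      simp only [ψ, Sum.elim_inl, Sum.elim_inr, incGraph]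
    · exact iff_of_false (hU _ (hφU x) _ (hφU y)) not_false
    · exact hmem _ _ (hg _ _ hv)
    · rw [G.adj_comm]
      exact hmem _ _ (hg _ _ hu)
    · exact iff_of_false (hC _ (hκC _ (hg _ _ hu)) _ (hκC _ (hg _ _ hv))) not_false

end Fraternal

section TreeSubdivision

open Classical

/-! ## Subgraphs of `1`-subdivisions of trees -/

/-- `T` has a bipartition in which all the vertices of one side have degree at most two. -/
def HasDegreeTwoSide {V : Type*} (T : SimpleGraph V) : Prop :=
  ∃ B : Set V, (∀ u v, T.Adj u v → (u ∈ B ↔ v ∉ B)) ∧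
    ∀ v ∈ B, ∃ a b, ∀ u, T.Adj v u → u = a ∨ u = b

lemma HasDegreeTwoSide.of_hom {V W : Type*} {T : SimpleGraph V} (f : T →g incGraph W)
    (hf : Function.Injective f) : HasDegreeTwoSide T := by
  refine ⟨{v | ∃ e, f v = Sum.inr e}, ?_, ?_⟩
  · intro u v huv
    have h := f.map_adj huv
    simp only [Set.mem_ofPred_eq]
    rcases hu : f u with x | e <;> rcases hv : f v with y | e' <;> rw [hu, hv] at h <;>
      simp [incGraph] at h ⊢
  · rintro v ⟨e, he⟩
    have : Nonempty V := ⟨v⟩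
    induction e with
    | h x y =>
      refine ⟨Function.invFun f (Sum.inl x), Function.invFun f (Sum.inl y), fun u hu => ?_⟩
      have h := f.map_adj hu
      have h2 := Function.leftInverse_invFun hf u
      rcases hu : f u with z | e' <;> rw [he, hu] at h <;> simp [incGraph] at h
      rw [hu] at h2
      rcases h with rfl | rfl
      · exact Or.inl h2.symm
      · exact Or.inr h2.symm

lemma HasDegreeTwoSide.of_isSubgraphOf_subdiv {V : Type*} {T : SimpleGraph V} {m : ℕ}
    {Y : SimpleGraph (Fin m)} (h : IsSubgraphOf T (Subdiv Y fun _ => 1)) :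
    HasDegreeTwoSide T := by
  obtain ⟨f, hf⟩ := h
  let g : (Fin m ⊕ Σ _ : Edges Y, Fin 1) → Fin m ⊕ Sym2 (Fin m) :=
    Sum.map id fun e => s(e.1.1.1, e.1.1.2)
  have hginj : Function.Injective g := by
    refine Sum.map_injective.mpr ⟨Function.injective_id, ?_⟩
    rintro ⟨⟨⟨a, b⟩, h1, h1'⟩, i⟩ ⟨⟨⟨c, d⟩, h2, h2'⟩, j⟩ h
    simp only [Sym2.eq_iff] at h h1 h2
    rcases h with ⟨rfl, rfl⟩ | ⟨rfl, rfl⟩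
    · rw [Subsingleton.elim i j]
    · exact absurd h1 h2.asymm
  have hrel : ∀ x y, subdivRel Y (fun _ => 1) x y → (incGraph (Fin m)).Adj (g x) (g y) := by
    rintro (x | ⟨e, i⟩) (y | ⟨e', j⟩) h
    · exact absurd h.choose_spec one_ne_zero
    · simp only [subdivRel] at h
      simp only [g, Sum.map_inl, Sum.map_inr, incGraph, Sym2.mem_iff]
      exact h.imp And.left And.left
    · exact h.elim
    · simp only [subdivRel] at h
      omega
  refine HasDegreeTwoSide.of_hom (W := Fin m) ⟨fun v => g (f v), ?_⟩ (hginj.comp hf)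
  intro u v huv
  obtain ⟨-, h | h⟩ := (fromRel_adj _ _ _).mp (f.map_adj huv)
  · exact hrel _ _ h
  · exact (hrel _ _ h).symm

lemma SimpleGraph.IsAcyclic.eq_of_common_neighbors {V : Type*} {T : SimpleGraph V}
    (hT : T.IsAcyclic) {u v x y : V} (huv : u ≠ v) (hx : T.Adj u x) (hx' : T.Adj v x)
    (hy : T.Adj u y) (hy' : T.Adj v y) : x = y := by
  have := hT.subsingleton_path u v
  have h := Subsingleton.elim
    (⟨Walk.cons hx (Walk.cons hx'.symm Walk.nil), by simp [huv, hx.ne, hx'.ne']⟩ : T.Path u v)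
    ⟨Walk.cons hy (Walk.cons hy'.symm Walk.nil), by simp [huv, hy.ne, hy'.ne']⟩
  simpa using congrArg (fun p : T.Path u v => p.1.support) h

/-- A forest with a side of degree at most two is an induced subgraph of the `1`-subdivision of
a forest on the same vertex set. -/
lemma SimpleGraph.IsAcyclic.exists_embedding_incGraph {V : Type*} {T : SimpleGraph V}
    (hT : T.IsAcyclic) (hB : HasDegreeTwoSide T) :
    ∃ F : SimpleGraph V, F.IsAcyclic ∧
      ∃ g : T ↪g incGraph V, ∀ v e, g v = Sum.inr e → e ∈ F.edgeSet := by
  obtain ⟨B, hB, hdeg⟩ := hB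
  have hpq : ∀ v, v ∈ B ∧ (∃ u, T.Adj v u) → ∃ p q, T.Adj v p ∧ (q = v ∨ T.Adj v q) ∧ p ≠ q ∧
      ∀ u, T.Adj v u → u = p ∨ u = q := by
    rintro v ⟨hv, u, hu⟩
    obtain ⟨a, b, hab⟩ := hdeg v hv
    by_cases h : ∃ w, T.Adj v w ∧ w ≠ u
    · obtain ⟨w, hw, hwu⟩ := h
      refine ⟨u, w, hu, Or.inr hw, hwu.symm, fun z hz => ?_⟩
      have h1 := hab u hu
      have h2 := hab w hw
      have h3 := hab z hz
      grind
    · push Not at h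
      exact ⟨u, v, hu, Or.inl rfl, hu.ne', fun z hz => Or.inl (h z hz)⟩
  set B' : Set V := {v | v ∈ B ∧ ∃ u, T.Adj v u} with hB'
  rcases isEmpty_or_nonempty V with hV | hV
  · exact ⟨⊥, isAcyclic_bot, ⟨⟨isEmptyElim, fun x => isEmptyElim x⟩, fun {x} => isEmptyElim x⟩,
      fun v => isEmptyElim v⟩
  choose! p q hp hq hne hnb using hpq
  have hpB : ∀ v ∈ B', p v ∉ B := fun v hv => (hB _ _ (hp v hv)).mp hv.1
  have hqB : ∀ v ∈ B', q v = v ∨ (T.Adj v (q v) ∧ q v ∉ B) := fun v hv =>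
    (hq v hv).imp_right fun h => ⟨h, (hB _ _ h).mp hv.1⟩
  have hinj : ∀ u ∈ B', ∀ v ∈ B', s(p u, q u) = s(p v, q v) → u = v := by
    intro u hu v hv h
    by_contra huv
    have h1 := hpB u hu
    have h2 := hpB v hv
    have h3 := hp u hu
    have h4 := hp v hv
    have h5 := hne u hu
    rcases Sym2.eq_iff.mp h with ⟨h6, h7⟩ | ⟨h6, h7⟩
    · rcases hqB u hu with h8 | h8 <;> rcases hqB v hv with h9 | h9
      · exact huv (h8.symm.trans (h7.trans h9))
      · exact h9.2 (h7 ▸ h8.symm ▸ hu.1)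
      · exact h8.2 (h7.symm ▸ h9.symm ▸ hv.1)
      · exact h5 (hT.eq_of_common_neighbors huv h3 (h6 ▸ h4) h8.1 (h7 ▸ h9.1))
    · rcases hqB u hu with h8 | h8
      · exact h2 (h7 ▸ h8.symm ▸ hu.1)
      · rcases hqB v hv with h9 | h9
        · exact h1 (h6 ▸ h9.symm ▸ hv.1)
        · exact h5 (hT.eq_of_common_neighbors huv h3 (h6 ▸ h9.1) h8.1 (h7 ▸ h4))
  let F : SimpleGraph V := fromEdgeSet {e | ∃ v ∈ B', e = s(p v, q v)}
  have hFmem : ∀ v ∈ B', s(p v, q v) ∈ F.edgeSet := fun v hv =>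
    (fromEdgeSet_adj _).mpr ⟨⟨v, hv, rfl⟩, hne v hv⟩
  let g : V → V ⊕ Sym2 V := fun v => if v ∈ B' then Sum.inr s(p v, q v) else Sum.inl v
  have hg : ∀ v ∈ B', g v = Sum.inr s(p v, q v) := fun v hv => if_pos hv
  have hg' : ∀ v ∉ B', g v = Sum.inl v := fun v hv => if_neg hv
  refine ⟨F, ?_, ⟨⟨g, ?_⟩, ?_⟩, ?_⟩
  · rw [isAcyclic_iff_forall_adj_isBridge]
    intro x y hxy
    obtain ⟨⟨v, hv, hxyv⟩, -⟩ := (fromEdgeSet_adj _).mp hxy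
    rw [hxyv, isBridge_iff]
    intro hreach
    set T' := T.deleteEdges {s(v, p v)} with hT'
    have hadj : ∀ w ∈ B', w ≠ v → ∀ z, T.Adj w z → T'.Adj w z := by
      intro w hw hwv z hwz
      refine deleteEdges_adj.mpr ⟨hwz, fun h => ?_⟩
      rcases Sym2.eq_iff.mp h with ⟨h1, -⟩ | ⟨h1, -⟩
      · exact hwv h1
      · exact hpB v hv (h1 ▸ hw.1)
    have hstep : ∀ a b, (F.deleteEdges {s(p v, q v)}).Adj a b → T'.Reachable a b := by
      intro a b hab
      obtain ⟨h1, h2⟩ := deleteEdges_adj.mp hab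
      obtain ⟨⟨w, hw, hw'⟩, -⟩ := (fromEdgeSet_adj _).mp h1
      have hwv : w ≠ v := by
        rintro rfl
        exact h2 (Set.mem_singleton_iff.mpr hw')
      have h3 : T'.Reachable (p w) (q w) := by
        refine (hadj w hw hwv _ (hp w hw)).reachable.symm.trans ?_
        rcases hq w hw with h | h
        · rw [h]
        · exact (hadj w hw hwv _ h).reachable
      rcases Sym2.eq_iff.mp hw' with ⟨rfl, rfl⟩ | ⟨rfl, rfl⟩
      · exact h3
      · exact h3.symm
    have hreach' : T'.Reachable (p v) (q v) := by
      have hwalk : ∀ a b, (F.deleteEdges {s(p v, q v)}).Walk a b → T'.Reachable a b := by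
        intro a b W
        induction W with
        | nil => exact Reachable.refl _
        | cons h _ ih => exact (hstep _ _ h).trans ih
      exact hreach.elim (hwalk _ _)
    have hqv : T'.Reachable (q v) v := by
      rcases hq v hv with h | h
      · rw [h]
      · refine Adj.reachable (deleteEdges_adj.mpr ⟨h.symm, fun h' => ?_⟩)
        have h1 := hne v hv
        rcases Sym2.eq_iff.mp h' with ⟨h2, h3⟩ | ⟨h2, -⟩
        · exact h.ne h2.symm
        · exact h1 h2.symm
    exact isBridge_iff.mp (isAcyclic_iff_forall_adj_isBridge.mp hT (hp v hv))
      (hreach'.trans hqv).symm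
  · intro u v h
    by_cases hu : u ∈ B' <;> by_cases hv : v ∈ B'
    · rw [hg u hu, hg v hv] at h
      exact hinj u hu v hv (Sum.inr_injective h)
    · rw [hg u hu, hg' v hv] at h
      exact absurd h (by simp)
    · rw [hg' u hu, hg v hv] at h
      exact absurd h (by simp)
    · rw [hg' u hu, hg' v hv] at h
      exact Sum.inl_injective h
  · have key : ∀ u ∈ B', ∀ v ∉ B', v ∈ s(p u, q u) ↔ T.Adj u v := by
      intro u hu v hv
      rw [Sym2.mem_iff]
      refine ⟨?_, hnb u hu v⟩
      rintro (rfl | rfl)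
      · exact hp u hu
      · rcases hq u hu with h | h
        · exact absurd hu (h ▸ hv)
        · exact h
    intro u v
    change (incGraph V).Adj (g u) (g v) ↔ T.Adj u v
    by_cases hu : u ∈ B' <;> by_cases hv : v ∈ B'
    · rw [hg u hu, hg v hv]
      exact iff_of_false not_false fun h => (hB _ _ h).mp hu.1 hv.1
    · rw [hg u hu, hg' v hv]
      exact key u hu v hv
    · rw [hg' u hu, hg v hv, T.adj_comm]
      exact key v hv u hu
    · rw [hg' u hu, hg' v hv]
      refine iff_of_false not_false fun h => ?_
      by_cases hv' : v ∈ B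
      · exact hv ⟨hv', u, h.symm⟩
      · exact hu ⟨(hB _ _ h).mpr hv', v, h⟩
  · intro v e h
    change g v = Sum.inr e at h
    by_cases hv : v ∈ B'
    · rw [hg v hv] at h
      exact Sum.inr_injective h ▸ hFmem v hv
    · rw [hg' v hv] at h
      exact absurd h (by simp)

lemma SimpleGraph.IsAcyclic.exists_tree_subdiv {n : ℕ} {T : SimpleGraph (Fin n)}
    (hT : T.IsAcyclic) (hB : HasDegreeTwoSide T) :
    ∃ (m : ℕ) (Y : SimpleGraph (Fin m)), Y.Connected ∧ Y.IsAcyclic ∧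
      IsSubgraphOf T (Subdiv Y fun _ => 1) := by
  rcases n.eq_zero_or_pos with rfl | hn
  · refine ⟨1, ⊥, ?_, isAcyclic_bot, ⟨isEmptyElim, fun {x} => isEmptyElim x⟩,
      fun x => isEmptyElim x⟩
    exact { preconnected := fun x y => by rw [Subsingleton.elim x y] }
  · have : Nonempty (Fin n) := ⟨⟨0, hn⟩⟩
    obtain ⟨F, hF, g, hg⟩ := hT.exists_embedding_incGraph hB
    obtain ⟨Y, hFY, -, hY⟩ := connected_top.exists_isTree_le_of_le_of_isAcyclic le_top hF
    refine ⟨n, Y, hY.1, hY.2, ?_⟩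
    have hz : ∀ v, ∃ z : Fin n ⊕ Σ _ : Edges Y, Fin 1, (∀ x, g v = Sum.inl x → z = Sum.inl x) ∧
        ∀ e, g v = Sum.inr e → ∃ d : Edges Y, e = s(d.1.1, d.1.2) ∧ z = Sum.inr ⟨d, 0⟩ := by
      intro v
      rcases hv : g v with x | e
      · exact ⟨Sum.inl x, by simp⟩
      · have he := hg v e hv
        induction e with
        | h x y =>
          have he := hFY he
          rcases lt_or_gt_of_ne he.ne with h | h
          · exact ⟨Sum.inr ⟨⟨(x, y), h, he⟩, 0⟩, by simp, fun e h => ⟨_, by simpa using h.symm, rfl⟩⟩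
          · exact ⟨Sum.inr ⟨⟨(y, x), h, he.symm⟩, 0⟩, by simp,
              fun e h => ⟨_, by rw [Sym2.eq_swap]; simpa using h.symm, rfl⟩⟩
    choose z hzl hzr using hz
    refine ⟨⟨z, ?_⟩, ?_⟩
    · have key : ∀ u v x e, g u = Sum.inl x → g v = Sum.inr e → x ∈ e →
          (Subdiv Y fun _ => 1).Adj (z u) (z v) := by
        intro u v x e hu hv hxe
        obtain ⟨d, rfl, hd⟩ := hzr v e hv
        rw [hzl u x hu, hd]
        refine (fromRel_adj _ _ _).mpr ⟨by simp, Or.inl ?_⟩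
        simpa [subdivRel] using hxe
      intro u v huv
      have h := g.map_adj_iff.mpr huv
      rcases hu : g u with x | e <;> rcases hv : g v with y | e' <;>
        rw [hu, hv] at h
      · exact h.elim
      · exact key u v x e' hu hv h
      · exact (key v u y e hv hu h).symm
      · exact h.elim
    · intro u v huv
      change z u = z v at huv
      apply g.injective
      rcases hu : g u with x | e <;> rcases hv : g v with y | e'
      · rw [hzl u x hu, hzl v y hv] at huv
        rw [Sum.inl_injective huv]
      · obtain ⟨d, rfl, hd⟩ := hzr v e' hv
        rw [hzl u x hu, hd] at huv
        exact absurd huv (by simp)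
      · obtain ⟨d, rfl, hd⟩ := hzr u e hu
        rw [hzl v y hv, hd] at huv
        exact absurd huv (by simp)
      · obtain ⟨d, rfl, hd⟩ := hzr u e hu
        obtain ⟨d', rfl, hd'⟩ := hzr v e' hv
        rw [hd, hd'] at huv
        have := congrArg Sigma.fst (Sum.inr_injective huv)
        simp only at this
        rw [this]

end TreeSubdivision

section StarChromaticBounds

open Classical

/-! ## Incidence graphs have unbounded star chromatic number -/

lemma omegaNum_le_two_of_iso_incGraph {V W : Type*} {G : SimpleGraph W} (e : G ≃g incGraph V) :
    omegaNum G ≤ 2 := by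
  refine csSup_le ⟨0, ⟨isEmptyElim, fun {x} => isEmptyElim x⟩, fun x => isEmptyElim x⟩ ?_
  rintro m ⟨f, hf⟩
  by_contra! hm
  have h : ∀ i j : Fin 3, i ≠ j →
      (incGraph V).Adj (e (f (Fin.castLE hm i))) (e (f (Fin.castLE hm j))) :=
    fun i j hij => e.map_adj_iff.mpr (f.map_adj ((Fin.castLE_injective hm).ne hij))
  have h1 := h 0 1 (by decide)
  have h2 := h 0 2 (by decide)
  have h3 := h 1 2 (by decide)
  generalize e (f (Fin.castLE hm 0)) = x, e (f (Fin.castLE hm 1)) = y,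
    e (f (Fin.castLE hm 2)) = z at h1 h2 h3
  rcases x with x | x <;> rcases y with y | y <;> rcases z with z | z <;>
    first | exact h1 | exact h2 | exact h3

lemma incGraph_eq_of_common_neighbors {V : Type*} {a a' b b' : V ⊕ Sym2 V} (ha : a ≠ a')
    (h1 : (incGraph V).Adj a b) (h2 : (incGraph V).Adj a b') (h3 : (incGraph V).Adj a' b)
    (h4 : (incGraph V).Adj a' b') : b = b' := by
  rcases a with x | e <;> rcases b with y | f <;> rcases a' with x' | e' <;>
    rcases b' with y' | f' <;>
    first | exact h1.elim | exact h2.elim | exact h3.elim | exact h4.elim | skip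
  · have hx : x ≠ x' := fun h => ha (h ▸ rfl)
    rw [(Sym2.mem_and_mem_iff hx).mp ⟨h1, h3⟩, (Sym2.mem_and_mem_iff hx).mp ⟨h2, h4⟩]
  · by_contra h
    have hy : y ≠ y' := fun hy => h (hy ▸ rfl)
    exact ha (by rw [(Sym2.mem_and_mem_iff hy).mp ⟨h1, h2⟩, (Sym2.mem_and_mem_iff hy).mp ⟨h3, h4⟩])

lemma not_isInducedSubgraphOf_incGraph {V W : Type*} {G : SimpleGraph W} (e : G ≃g incGraph V)
    {r t : ℕ} (hr : 2 ≤ r) (ht : 2 ≤ t) :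
    ¬ IsInducedSubgraphOf (completeBipartiteGraph (Fin r) (Fin t)) G := by
  rintro ⟨f⟩
  have h : ∀ i j, (incGraph V).Adj (e (f (Sum.inl i))) (e (f (Sum.inr j))) := fun i j =>
    e.map_adj_iff.mpr (f.map_adj_iff.mpr (by simp))
  have hinj := e.injective.comp f.injective
  have h0 : (Sum.inl ⟨0, by omega⟩ : Fin r ⊕ Fin t) ≠ Sum.inl ⟨1, hr⟩ := by simp
  have h1 : (Sum.inr ⟨0, by omega⟩ : Fin r ⊕ Fin t) ≠ Sum.inr ⟨1, ht⟩ := by simp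
  exact hinj.ne h1 (incGraph_eq_of_common_neighbors (hinj.ne h0) (h _ _) (h _ _) (h _ _) (h _ _))

lemma le_of_isStarColoring_incGraph {n N : ℕ} {c : Fin n ⊕ Sym2 (Fin n) → Fin N}
    (hc : IsStarColoring (incGraph (Fin n)) c) : n ≤ N * (N + 1) := by
  by_contra! hn
  obtain ⟨k, hk⟩ := Fintype.exists_lt_card_fiber_of_mul_lt_card
    (fun v : Fin n => c (Sum.inl v)) (n := N + 1) (by simpa using hn)
  obtain ⟨v, hv⟩ := Finset.card_pos.mp (lt_of_le_of_lt (Nat.zero_le _) hk)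
  have hcard := Finset.card_erase_of_mem hv
  obtain ⟨u, hu, w, hw, huw, h⟩ := Finset.exists_ne_map_eq_of_card_lt_of_maps_to
    (t := (Finset.univ : Finset (Fin N))) (f := fun u => c (Sum.inr s(v, u)))
    (by rw [hcard, Finset.card_univ, Fintype.card_fin]; omega) (fun _ _ => by simp)
  simp only [Finset.mem_erase, Finset.mem_filter, Finset.mem_univ, true_and] at hu hw hv
  refine hc.2 (Sum.inl u) (Sum.inr s(v, u)) (Sum.inl v) (Sum.inr s(v, w)) ?_ ?_ ?_ ?_ ?_ ?_
    ⟨hu.2.trans hv.symm, h⟩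
  · exact Sym2.mem_mk_right v u
  · exact Sym2.mem_mk_left v u
  · exact Sym2.mem_mk_left v w
  · simpa using hu.1
  · exact fun h => huw (Sym2.congr_right.mp (Sum.inr_injective h))
  · simp

lemma exists_isStarColoring_starChi {n : ℕ} (G : SimpleGraph (Fin n)) :
    ∃ c : Fin n → Fin (starChi G), IsStarColoring G c :=
  Nat.sInf_mem (s := {N | ∃ c : Fin n → Fin N, IsStarColoring G c})
    ⟨n, id, fun _ _ h => h.ne, fun _ _ _ _ _ _ _ hxz _ _ h => hxz h.1⟩

/-- If the `(T, K_{r,t})`-free graphs are `χ_s`-bounded and `r ≥ 2`, then `T` has a bipartition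
with a side of degree at most two. -/
lemma hasDegreeTwoSide_of_starChi_bounded {V : Type*} {T : SimpleGraph V} {r t : ℕ} (hr : 2 ≤ r)
    (ht : 2 ≤ t) (f : ℕ → ℕ)
    (hf : ∀ (n : ℕ) (G : SimpleGraph (Fin n)), ¬ IsInducedSubgraphOf T G →
      ¬ IsInducedSubgraphOf (completeBipartiteGraph (Fin r) (Fin t)) G →
      starChi G ≤ f (omegaNum G)) : HasDegreeTwoSide T := by
  by_contra hT
  set M := f 0 + f 1 + f 2 with hM
  set n := M * (M + 1) + 1 with hn
  let e := (incGraph (Fin n)).overFinIso rfl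
  set G := (incGraph (Fin n)).overFin rfl
  have hω := omegaNum_le_two_of_iso_incGraph e.symm
  have h1 : starChi G ≤ M := by
    refine (hf _ G ?_ (not_isInducedSubgraphOf_incGraph e.symm hr ht)).trans ?_
    · rintro ⟨g⟩
      exact hT (HasDegreeTwoSide.of_hom (e.symm.toHom.comp g.toHom)
        (e.symm.injective.comp g.injective))
    · interval_cases omegaNum G <;> omega
  obtain ⟨c, hc, hc'⟩ := exists_isStarColoring_starChi G
  have h2 : n ≤ starChi G * (starChi G + 1) :=
    le_of_isStarColoring_incGraph (c := fun v => c (e v))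
      ⟨fun u v h => hc _ _ (e.map_adj_iff.mpr h), fun x y z w h1 h2 h3 h4 h5 h6 =>
        hc' _ _ _ _ (e.map_adj_iff.mpr h1) (e.map_adj_iff.mpr h2) (e.map_adj_iff.mpr h3)
          (e.injective.ne h4) (e.injective.ne h5) (e.injective.ne h6)⟩
  have h3 := Nat.mul_le_mul h1 (Nat.add_le_add_right h1 1)
  omega

/-! ## Upper bounds on the star chromatic number -/

lemma card_le_omegaNum {n : ℕ} (G : SimpleGraph (Fin n)) (C : Finset (Fin n))
    (hC : ∀ x ∈ C, ∀ y ∈ C, x ≠ y → G.Adj x y) : C.card ≤ omegaNum G := by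
  refine le_csSup ⟨n, ?_⟩ ?_
  · rintro m ⟨f, hf⟩
    simpa using Fintype.card_le_of_injective f hf
  · let g := (Finset.equivFinOfCardEq (s := C) rfl).symm
    have hg : Function.Injective fun i => (g i : Fin n) :=
      Subtype.val_injective.comp g.injective
    exact ⟨⟨fun i => g i, fun {i j} h => hC _ (g i).2 _ (g j).2 (hg.ne h)⟩, hg⟩

lemma isInducedSubgraphOf_completeBipartiteGraph {V : Type*} {G : SimpleGraph V} {r t : ℕ}
    (C D : Finset V) (hCr : C.card = r) (hDt : D.card = t)
    (hC : ∀ x ∈ C, ∀ y ∈ C, ¬ G.Adj x y) (hD : ∀ x ∈ D, ∀ y ∈ D, ¬ G.Adj x y)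
    (hCD : ∀ x ∈ C, ∀ y ∈ D, G.Adj x y) :
    IsInducedSubgraphOf (completeBipartiteGraph (Fin r) (Fin t)) G := by
  let g := (Finset.equivFinOfCardEq hCr).symm
  let h := (Finset.equivFinOfCardEq hDt).symm
  refine ⟨⟨⟨Sum.elim (fun i => (g i : V)) fun j => (h j : V), ?_⟩, ?_⟩⟩
  · exact Sum.elim_injective.mpr ⟨Subtype.val_injective.comp g.injective,
      Subtype.val_injective.comp h.injective, fun i j => (hCD _ (g i).2 _ (h j).2).ne⟩
  · rintro (i | i) (j | j)
    · exact iff_of_false (hC _ (g i).2 _ (g j).2) (by simp)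
    · exact iff_of_true (hCD _ (g i).2 _ (h j).2) (by simp)
    · exact iff_of_true (hCD _ (g j).2 _ (h i).2).symm (by simp)
    · exact iff_of_false (hD _ (h i).2 _ (h j).2) (by simp)

lemma starChi_le_of_conflictGraph {n : ℕ} (G : SimpleGraph (Fin n)) (out : Fin n → Finset (Fin n))
    (hout : ∀ u v, G.Adj u v → u ∈ out v ∨ v ∈ out u) (k : ℕ)
    (hk : ∀ X : Finset (Fin n), X.Nonempty →
      ∃ v ∈ X, (X.filter ((conflictGraph G out).Adj v)).card ≤ k) : starChi G ≤ k + 1 := by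
  obtain ⟨c, hc⟩ := colorable_of_degenerate _ k hk
  exact Nat.sInf_le ⟨c, isStarColoring_of_conflictGraph hout hc⟩

lemma exists_card_filter_adj_le {V : Type*} (G : SimpleGraph V) (k : ℕ) (X : Finset V)
    (hX : X.Nonempty) (h : (adjPairs G X).card ≤ k * X.card) :
    ∃ v ∈ X, (X.filter (G.Adj v)).card ≤ k := by
  by_contra! hk
  have h1 := le_card_adjPairs G X (k + 1) fun v hv => hk v hv
  have h2 := hX.card_pos
  nlinarith

/-- `K_{1,t}`-free graphs of bounded clique number have bounded degree, and hence bounded star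
chromatic number. -/
lemma exists_starChi_le_of_star_free (t w : ℕ) : ∃ D, ∀ (n : ℕ) (G : SimpleGraph (Fin n)),
    ¬ IsInducedSubgraphOf (completeBipartiteGraph (Fin 1) (Fin t)) G → omegaNum G = w →
    starChi G ≤ D := by
  obtain ⟨R, hR⟩ := exists_ramsey (w + 1) t
  refine ⟨R + R * R + 1, fun n G hG hw => ?_⟩
  let N : Fin n → Finset (Fin n) := fun v => Finset.univ.filter (G.Adj v)
  have hN : ∀ v, (N v).card ≤ R := by
    intro v
    by_contra! hv
    rcases hR G (N v) hv.le with ⟨C, -, hC, hC'⟩ | ⟨C, hCN, hC, hC'⟩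
    · have := card_le_omegaNum G C hC'
      omega
    · refine hG (isInducedSubgraphOf_completeBipartiteGraph {v} C (by simp) hC (by simp) hC' ?_)
      intro x hx y hy
      rw [Finset.mem_singleton.mp hx]
      exact (Finset.mem_filter.mp (hCN hy)).2
  refine starChi_le_of_conflictGraph G N (fun u v h => Or.inr (by simp [N, h])) _ fun X hX => ?_
  obtain ⟨v, hv⟩ := hX
  refine ⟨v, hv, (Finset.card_le_card (t := N v ∪ (N v).biUnion N) ?_).trans ?_⟩
  · intro u hu
    obtain ⟨-, h | ⟨z, h1, h2, -⟩⟩ := (Finset.mem_filter.mp hu).2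
    · exact Finset.mem_union_left _ (by simp [N, h])
    · exact Finset.mem_union_right _ (Finset.mem_biUnion.mpr ⟨z, by simp [N, h1], by simp [N, h2]⟩)
  · refine (Finset.card_union_le _ _).trans (Nat.add_le_add (hN v) ?_)
    refine Finset.card_biUnion_le.trans ?_
    refine (Finset.sum_le_card_nsmul _ _ R fun v _ => hN v).trans ?_
    rw [smul_eq_mul]
    exact Nat.mul_le_mul_right _ (hN v)

lemma exists_bicliqueFree (r t w : ℕ) (hrt : r ≤ t) : ∃ R, ∀ (n : ℕ) (G : SimpleGraph (Fin n)),
    ¬ IsInducedSubgraphOf (completeBipartiteGraph (Fin r) (Fin t)) G → omegaNum G = w →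
    BicliqueFree G R := by
  obtain ⟨R, hR⟩ := exists_ramsey (w + 1) t
  refine ⟨R, ?_⟩
  rintro n G hG hw ⟨J, Z, hJ, hZ, hJZ⟩
  rcases hR G J hJ.ge with ⟨C, -, hC, hC'⟩ | ⟨C, hCJ, hC, hC'⟩
  · have := card_le_omegaNum G C hC'
    omega
  rcases hR G Z hZ.ge with ⟨D, -, hD, hD'⟩ | ⟨D, hDZ, hD, hD'⟩
  · have := card_le_omegaNum G D hD'
    omega
  obtain ⟨C₁, hC₁, hC₁r⟩ := Finset.exists_subset_card_eq (hC ▸ hrt)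
  exact hG (isInducedSubgraphOf_completeBipartiteGraph C₁ D hC₁r hD
    (fun x hx y hy => hC' x (hC₁ hx) y (hC₁ hy)) hD'
    fun x hx y hy => hJZ x (hCJ (hC₁ hx)) y (hDZ hy))

/-- If `T` is a forest with a side of degree at most two, then the `(T, K_{r,t})`-free graphs of
bounded clique number have bounded star chromatic number. -/
lemma exists_starChi_le_of_hasDegreeTwoSide {V : Type*} [Fintype V] {T : SimpleGraph V}
    (hT : T.IsAcyclic) (hB : HasDegreeTwoSide T) (r t w : ℕ) (hrt : r ≤ t) :
    ∃ D, ∀ (n : ℕ) (G : SimpleGraph (Fin n)), ¬ IsInducedSubgraphOf T G →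
      ¬ IsInducedSubgraphOf (completeBipartiteGraph (Fin r) (Fin t)) G → omegaNum G = w →
      starChi G ≤ D := by
  obtain ⟨R, hR⟩ := exists_bicliqueFree r t w hrt
  obtain ⟨k, hk⟩ := hT.exists_embedsOn_of_dense R Finset.univ
  obtain ⟨F, hF, g, hg⟩ := hT.exists_embedding_incGraph hB
  refine ⟨2 * (k + k * k) + k * k * (2 ^ (4 * k + 4) * (k + 2 * Fintype.card V)) + 1,
    fun n G hTG hG hw => ?_⟩
  have hdense : ∀ X : Finset (Fin n), (adjPairs G X).card ≤ k * X.card := by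
    intro X
    by_contra! hX
    obtain ⟨φ, -, hφ, hφ'⟩ := hk G (hR n G hG hw) X hX
    exact hTG ⟨⟨⟨φ, fun x y h => hφ (by simp) (by simp) h⟩, fun {x y} =>
      (hφ' x (Finset.mem_univ x) y (Finset.mem_univ y)).symm⟩⟩
  obtain ⟨out, hout1, hout2, hout3⟩ := exists_orientation G k fun X hX =>
    exists_card_filter_adj_le G k X hX (hdense X)
  refine starChi_le_of_conflictGraph G out hout3 _ fun X hX =>
    exists_card_filter_adj_le _ _ X hX ?_
  refine (card_adjPairs_conflictGraph_le G out k hout1 hout3 X).trans ?_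
  rw [Nat.add_mul]
  refine Nat.add_le_add_left ?_ _
  by_contra! hfr
  obtain ⟨U, C, a, b, h1, h2, h3, h4, h5, h6, h7⟩ :=
    exists_dense_subdivision G out k _ hout1 hout2 hout3 X hfr
  exact hTG (exists_embedding_of_dense_subdivision hF g hg G U C a b h1 h2 h3 h4 h5 h6 h7)

end StarChromaticBounds

/-- For a forest `T` and positive integers `r ≤ t`, the class of all
`(T, K_{r,t})`-free graphs is `χ_s`-bounded iff `r = 1` or `T` is a subgraph of the
`1`-subdivision of some tree. -/
theorem TKrt_free_starChi_bounded_iff (nT : ℕ) (T : SimpleGraph (Fin nT))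
    (hT : T.IsAcyclic) (r t : ℕ) (hr : 1 ≤ r) (hrt : r ≤ t) :
    (∃ f : ℕ → ℕ, ∀ (n : ℕ) (G : SimpleGraph (Fin n)),
        ¬ IsInducedSubgraphOf T G →
        ¬ IsInducedSubgraphOf (completeBipartiteGraph (Fin r) (Fin t)) G →
        starChi G ≤ f (omegaNum G)) ↔
      (r = 1 ∨ ∃ (m : ℕ) (Y : SimpleGraph (Fin m)), Y.Connected ∧ Y.IsAcyclic ∧
        IsSubgraphOf T (Subdiv Y (fun _ => 1))) := by
  constructor
  · rintro ⟨f, hf⟩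
    rcases hr.eq_or_lt with h | h
    · exact Or.inl h.symm
    · exact Or.inr (hT.exists_tree_subdiv
        (hasDegreeTwoSide_of_starChi_bounded h (h.trans_le hrt) f hf))
  · rintro (rfl | ⟨m, Y, -, -, hY⟩)
    · choose f hf using exists_starChi_le_of_star_free t
      exact ⟨f, fun n G _ hG => hf _ n G hG rfl⟩
    · choose f hf using fun w => exists_starChi_le_of_hasDegreeTwoSide hT
        (HasDegreeTwoSide.of_isSubgraphOf_subdiv hY) r t w hrt
      exact ⟨f, fun n G hTG hG => hf _ n G hTG hG rfl⟩
end

section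
/- Let T be a forest that is not a subgraph of the 1-subdivision of any tree, and let k be a positive integer. Then the class of all graphs that are T-free, C_{2j}-free for every j with 2 ≤ j ≤ k, and contain no induced odd cycle of length at least 5, is not χ_s-bounded; in fact this class contains triangle-free graphs of arbitrarily large star chromatic number. -/
open SimpleGraph

/-! ## Graphs that are locally sparse and of large chromatic number -/

open Finset in
theorem card_mul_pow_le_of_prescribed_values {ι α : Type*} [Fintype ι] [Fintype α]
    [DecidableEq ι]
    {s : ℕ} (e : Fin s ↪ ι) (w : Fin s → α) (S : Finset (ι → α))
    (hS : ∀ f ∈ S, ∀ j, f (e j) = w j) :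
    #S * Fintype.card α ^ s ≤ Fintype.card (ι → α) := by
  have key : Function.Injective
      (fun p : S × (Fin s → α) => Function.extend e p.2 p.1.1) := by
    rintro ⟨⟨f, hf⟩, u⟩ ⟨⟨f', hf'⟩, u'⟩ h
    simp only at h
    have hu : u = u' := by
      funext j
      simpa [e.injective.extend_apply] using congrFun h (e j)
    have hff : f = f' := by
      funext i
      by_cases hi : ∃ j, e j = i
      · obtain ⟨j, rfl⟩ := hi
        rw [hS f hf, hS f' hf']
      · simpa [Function.extend_apply' _ _ _ hi] using congrFun h i
    subst hu hff
    rfl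
  have := Fintype.card_le_of_injective _ key
  simpa [Fintype.card_prod] using this

/-- `s`-tuples of vertices, `s` distinct edge labels, and a choice of ends in the tuple for each
of the labels. -/
abbrev DenseSpot (ι V : Type*) (s : ℕ) : Type _ :=
  (Fin s → V) × (Fin s ↪ ι) × (Fin s → Fin s × Fin s)

/-- The labelled pairs `f` realise the dense spot `d`. -/
def DenseSpot.Occurs {ι V : Type*} {s : ℕ} (d : DenseSpot ι V s) (f : ι → V × V) : Prop :=
  ∀ j, f (d.2.1 j) = (d.1 (d.2.2 j).1, d.1 (d.2.2 j).2)

open Finset Classical in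
theorem sum_card_occurs_le {ι V : Type*} [Fintype ι] [Fintype V]
    [DecidableEq ι] [DecidableEq V] [Nonempty V] {D : ℕ}
    (hι : Fintype.card ι = D * Fintype.card V) (s : ℕ) :
    ∑ f : ι → V × V, #{d : DenseSpot ι V s | d.Occurs f} ≤
      (D * s ^ 2) ^ s * Fintype.card (ι → V × V) := by
  have hswap : ∑ f : ι → V × V, #{d : DenseSpot ι V s | d.Occurs f} =
      ∑ d : DenseSpot ι V s, #{f : ι → V × V | d.Occurs f} := by
    simp only [Finset.card_filter]
    exact Finset.sum_comm
  have hpos : 0 < Fintype.card (V × V) ^ s := by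
    have : 0 < Fintype.card (V × V) := Fintype.card_pos
    positivity
  refine Nat.le_of_mul_le_mul_right ?_ hpos
  rw [hswap, Finset.sum_mul]
  calc ∑ d : DenseSpot ι V s, #{f : ι → V × V | d.Occurs f} * Fintype.card (V × V) ^ s
      ≤ ∑ d : DenseSpot ι V s, Fintype.card (ι → V × V) :=
        Finset.sum_le_sum fun d _ =>
          card_mul_pow_le_of_prescribed_values d.2.1
            (fun j => (d.1 (d.2.2 j).1, d.1 (d.2.2 j).2)) _ fun f hf => (mem_filter.1 hf).2
    _ = Fintype.card (DenseSpot ι V s) * Fintype.card (ι → V × V) := by simp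
    _ ≤ (Fintype.card V ^ s * ((D * Fintype.card V) ^ s * (s * s) ^ s)) *
          Fintype.card (ι → V × V) := by
        gcongr
        rw [← hι]
        simp only [DenseSpot, Fintype.card_prod, Fintype.card_embedding_eq, Fintype.card_fun,
          Fintype.card_fin]
        gcongr
        exact Nat.descFactorial_le_pow _ _
    _ = (D * s ^ 2) ^ s * Fintype.card (ι → V × V) * Fintype.card (V × V) ^ s := by
        rw [Fintype.card_prod V V]
        simp only [mul_pow, ← pow_mul]
        ring

open Finset in
theorem card_funs_missing_square_le {ι V : Type*} [Fintype ι] [Fintype V] [DecidableEq ι]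
    [DecidableEq V] (x : ℕ) (S : Finset (ι → V × V))
    (hS : ∀ f ∈ S, ∃ X : Finset V, #X = x ∧ ∀ i, f i ∉ X ×ˢ X) :
    #S ≤ 2 ^ Fintype.card V * (Fintype.card V ^ 2 - x ^ 2) ^ Fintype.card ι := by
  have hsub : S ⊆ (powersetCard x (univ : Finset V)).biUnion
      fun X => Fintype.piFinset fun _ : ι => (X ×ˢ X)ᶜ := by
    intro f hf
    simpa [mem_powersetCard] using hS f hf
  refine (card_le_card hsub).trans ((card_biUnion_le_card_mul _ _
    ((Fintype.card V ^ 2 - x ^ 2) ^ Fintype.card ι) ?_).trans ?_)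
  · intro X hX
    rw [mem_powersetCard] at hX
    simp [Fintype.card_piFinset, card_compl, hX.2, sq]
  · gcongr
    simpa using Nat.choose_le_two_pow (Fintype.card V) x

theorem exists_four_mul_pow_le {q : ℕ} (hq : 2 ≤ q) : ∃ D : ℕ, 4 * (q - 1) ^ D ≤ q ^ D := by
  obtain ⟨p, rfl⟩ : ∃ p, q = p + 1 := ⟨q - 1, by omega⟩
  refine ⟨4 * p, ?_⟩
  have h := one_add_mul_le_pow (a := (1 / p : ℚ)) (by
    have : (0:ℚ) ≤ 1 / p := by positivity
    linarith) (4 * p)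
  have hp : (0 : ℚ) < p := by
    have : 0 < p := by omega
    exact_mod_cast this
  have h2 : (4 : ℚ) * p ^ (4 * p) ≤ (p + 1) ^ (4 * p) := by
    have h3 : (p + 1 : ℚ) = (1 + 1 / p) * p := by field_simp
    rw [h3, mul_pow]
    gcongr
    refine le_trans ?_ h
    push_cast
    field_simp
    linarith
  simpa using (by exact_mod_cast h2 : 4 * p ^ (4 * p) ≤ (p + 1) ^ (4 * p))

/-- Every nonempty set of at most `g` vertices of `H` spans fewer edges than it has vertices. -/
def LocallySparse {V : Type*} (H : SimpleGraph V) (g : ℕ) : Prop :=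
  ∀ (W : Finset V) (A : Finset (Sym2 V)), (A : Set (Sym2 V)) ⊆ H.edgeSet →
    (∀ e ∈ A, ∀ v ∈ e, v ∈ W) → W.Nonempty → W.card ≤ g → A.card < W.card

open Finset Classical in
theorem exists_few_dense_spots (g c : ℕ) (hc : 0 < c) :
    ∃ (n m x K : ℕ) (f : Fin m → Fin n × Fin n), n = 2 * c * x ∧ 0 < x ∧ K ≤ c * x ∧
      ∑ s : Fin (g + 1), #{d : DenseSpot (Fin m) (Fin n) (s + 1) | d.Occurs f} ≤ K ∧
      ∀ X : Finset (Fin n), #X = x → ∃ i, f i ∈ X ×ˢ X := by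
  set q := 4 * c ^ 2 with hq
  have hq2 : 2 ≤ q := by nlinarith
  obtain ⟨D, hD⟩ := exists_four_mul_pow_le hq2
  set K := ∑ s : Fin (g + 1), (D * (s + 1) ^ 2) ^ ((s : ℕ) + 1) with hK
  set x := 2 * K + 1 with hx
  set n := 2 * c * x with hn
  have hn0 : 0 < n := by positivity
  have : Nonempty (Fin n) := ⟨⟨0, hn0⟩⟩
  set N := Fintype.card (Fin (D * n) → Fin n × Fin n) with hN
  have hNpos : 0 < N := Fintype.card_pos
  let cnt (f : Fin (D * n) → Fin n × Fin n) : ℕ :=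
    ∑ s : Fin (g + 1), #{d : DenseSpot (Fin (D * n)) (Fin n) (s + 1) | d.Occurs f}
  have hsum : ∑ f, cnt f ≤ K * N := by
    simp only [cnt]
    rw [Finset.sum_comm, hK, Finset.sum_mul]
    refine Finset.sum_le_sum fun s _ => ?_
    exact_mod_cast sum_card_occurs_le (V := Fin n) (ι := Fin (D * n)) (D := D) (by simp) (s + 1)
  set B : Finset (Fin (D * n) → Fin n × Fin n) :=
    {f | ∃ X : Finset (Fin n), #X = x ∧ ∀ i, f i ∉ X ×ˢ X} with hB
  have hBcard : 2 * #B < N := by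
    have h1 := card_funs_missing_square_le (ι := Fin (D * n)) (V := Fin n) x B
      fun f hf => by simpa [hB] using hf
    simp only [Fintype.card_fin] at h1
    have h2 : n ^ 2 - x ^ 2 = (q - 1) * x ^ 2 := by
      rw [Nat.sub_mul, one_mul, hn, hq]
      congr 1
      ring
    have h3 : N = q ^ (D * n) * (x ^ 2) ^ (D * n) := by
      rw [← mul_pow, hN]
      simp only [Fintype.card_fun, Fintype.card_prod, Fintype.card_fin]
      congr 1
      rw [hn, hq]
      ring
    have h4 : 4 ^ n * (q - 1) ^ (D * n) ≤ q ^ (D * n) := by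
      simpa only [pow_mul, mul_pow] using Nat.pow_le_pow_left hD n
    have h5 : 2 * 2 ^ n < 4 ^ n := by
      have h6 : 2 < 2 ^ n := by
        have : 2 ≤ n := by nlinarith
        calc 2 < 2 ^ 2 := by norm_num
          _ ≤ 2 ^ n := Nat.pow_le_pow_right (by norm_num) this
      calc 2 * 2 ^ n < 2 ^ n * 2 ^ n := by gcongr
        _ = 4 ^ n := by rw [← mul_pow]; norm_num
    have h7 : 0 < (q - 1) ^ (D * n) := pow_pos (by omega) _
    calc 2 * #B ≤ 2 * (2 ^ n * ((q - 1) * x ^ 2) ^ (D * n)) := by rw [← h2]; gcongr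
      _ = (2 * 2 ^ n) * ((q - 1) ^ (D * n) * (x ^ 2) ^ (D * n)) := by rw [mul_pow]; ring
      _ < 4 ^ n * ((q - 1) ^ (D * n) * (x ^ 2) ^ (D * n)) := by gcongr
      _ = (4 ^ n * (q - 1) ^ (D * n)) * (x ^ 2) ^ (D * n) := by ring
      _ ≤ N := by rw [h3]; gcongr
  have hex : ∃ f, f ∉ B ∧ cnt f ≤ 2 * K := by
    by_contra! hcon
    have h1 : #Bᶜ * (2 * K + 1) ≤ ∑ f ∈ Bᶜ, cnt f := by
      rw [← smul_eq_mul]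
      exact Finset.card_nsmul_le_sum _ _ _ fun f hf => hcon f (by simpa using hf)
    have h2 : ∑ f ∈ Bᶜ, cnt f ≤ ∑ f, cnt f :=
      Finset.sum_le_sum_of_subset (subset_univ _)
    have h3 : N < 2 * #Bᶜ := by
      rw [card_compl, ← hN]
      omega
    nlinarith
  obtain ⟨f, hfB, hf⟩ := hex
  refine ⟨n, D * n, x, 2 * K, f, rfl, by omega, ?_, hf, ?_⟩
  · nlinarith
  · simpa [hB] using hfB

open Finset Classical in
/-- Graphs that are simultaneously locally sparse and of large chromatic number exist. -/
theorem exists_locallySparse_not_colorable (g c : ℕ) :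
    ∃ (n : ℕ) (H : SimpleGraph (Fin n)), 0 < n ∧ LocallySparse H g ∧ ¬ H.Colorable c := by
  wlog hc : 0 < c generalizing c
  · obtain ⟨n, H, hn, hH, hcol⟩ := this (c + 1) (by omega)
    exact ⟨n, H, hn, hH, fun h => hcol (h.mono (by omega))⟩
  obtain ⟨n, m, x, K, f, hn, hx, hKx, hcnt, hX⟩ := exists_few_dense_spots g c hc
  let S : Finset (Fin n) := univ.biUnion fun s : Fin (g + 1) =>
    ({d : DenseSpot (Fin m) (Fin n) (s + 1) | d.Occurs f} : Finset _).image fun d => d.1 0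
  have hS : #S ≤ K := by
    refine (card_biUnion_le.trans (Finset.sum_le_sum fun s _ => card_image_le)).trans hcnt
  have hmemS : ∀ s (hs : s ≤ g) (d : DenseSpot (Fin m) (Fin n) (s + 1)), d.Occurs f →
      d.1 0 ∈ S := by
    intro s hs d hd
    simp only [S, mem_biUnion, mem_univ, true_and, mem_image, mem_filter]
    exact ⟨⟨s, by omega⟩, d, hd, rfl⟩
  let H : SimpleGraph (Fin n) :=
    { Adj := fun u v => u ≠ v ∧ u ∉ S ∧ v ∉ S ∧ ∃ i, f i = (u, v) ∨ f i = (v, u)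
      symm := ⟨by
        rintro u v ⟨h1, h2, h3, i, hi⟩
        exact ⟨h1.symm, h3, h2, i, hi.symm⟩⟩
      loopless := ⟨fun u h => h.1 rfl⟩ }
  refine ⟨n, H, by rw [hn]; positivity, ?_, ?_⟩
  · intro W A hA hAW hWne hWg
    by_contra! hcard
    obtain ⟨s, hs⟩ : ∃ s, #W = s + 1 := ⟨#W - 1, by have := hWne.card_pos; omega⟩
    obtain ⟨A', hA'A, hA'⟩ := exists_subset_card_eq (hs ▸ hcard)
    let w := (W.equivFinOfCardEq hs).symm
    let a := (A'.equivFinOfCardEq hA').symm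
    have hends : ∀ j : Fin (s + 1), ∃ (i : Fin m) (p : Fin (s + 1) × Fin (s + 1)),
        f i = ((w p.1 : Fin n), (w p.2 : Fin n)) ∧
        s((w p.1 : Fin n), (w p.2 : Fin n)) = (a j : Sym2 (Fin n)) := by
      intro j
      have haA : (a j : Sym2 (Fin n)) ∈ A := hA'A (a j).2
      generalize (a j : Sym2 (Fin n)) = e at haA
      induction e using Sym2.ind with
      | _ u v =>
        have hu : u ∈ W := hAW _ haA u (by simp)
        have hv : v ∈ W := hAW _ haA v (by simp)
        obtain ⟨-, -, -, i, hi⟩ : H.Adj u v := hA haA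
        rcases hi with hi | hi
        · exact ⟨i, (w.symm ⟨u, hu⟩, w.symm ⟨v, hv⟩), by simp [hi]⟩
        · exact ⟨i, (w.symm ⟨v, hv⟩, w.symm ⟨u, hu⟩), by simp [hi, Sym2.eq_swap]⟩
    choose i p hi hp using hends
    have hinj : Function.Injective i := by
      intro j j' hjj
      have h1 : f (i j) = f (i j') := by rw [hjj]
      rw [hi, hi, Prod.mk.injEq] at h1
      have h2 : (a j : Sym2 (Fin n)) = a j' := by rw [← hp, ← hp, h1.1, h1.2]
      exact a.injective (Subtype.ext h2)
    -- rotate the tuple so that an end of the first edge comes first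
    let d : DenseSpot (Fin m) (Fin n) (s + 1) :=
      (fun k => (w (Equiv.swap 0 (p 0).1 k) : Fin n), ⟨i, hinj⟩,
        fun j => (Equiv.swap 0 (p 0).1 (p j).1, Equiv.swap 0 (p 0).1 (p j).2))
    have hd : d.Occurs f := by
      intro j
      simp [d, hi]
    have h0 := hmemS s (by omega) d hd
    have hadj : H.Adj (w (p 0).1 : Fin n) (w (p 0).2) := by
      rw [← SimpleGraph.mem_edgeSet, hp]
      exact hA (hA'A (a 0).2)
    exact hadj.2.1 (by simpa [d] using h0)
  · rintro ⟨C⟩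
    obtain ⟨y, -, hy⟩ := exists_lt_card_fiber_of_mul_lt_card_of_maps_to (s := Sᶜ)
      (t := (univ : Finset (Fin c))) (f := C) (n := x - 1) (fun _ _ => mem_univ _) (by
        rw [card_univ, card_compl, Fintype.card_fin, Fintype.card_fin, Nat.mul_sub]
        have : c * 1 ≤ c * x := Nat.mul_le_mul_left _ hx
        have : n = 2 * (c * x) := by rw [hn]; ring
        omega)
    obtain ⟨X, hXsub, hXcard⟩ := exists_subset_card_eq (show x ≤ _ by exact Nat.le_of_pred_lt hy)
    obtain ⟨i, hi⟩ := hX X hXcard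
    rw [mem_product] at hi
    have h1 := hXsub hi.1
    have h2 := hXsub hi.2
    simp only [mem_filter, mem_compl] at h1 h2
    have hne : (f i).1 ≠ (f i).2 := by
      intro heq
      refine h1.1 (hmemS 0 (by omega)
        (fun _ => (f i).1, ⟨fun _ => i, fun _ _ _ => Subsingleton.elim (α := Fin 1) _ _⟩,
          fun _ => (0, 0)) ?_)
      intro j
      exact Prod.ext rfl heq.symm
    exact C.valid (v := (f i).1) (w := (f i).2) ⟨hne, h1.1, h2.1, i, Or.inl rfl⟩
      (h1.2.trans h2.2.symm)

theorem LocallySparse.isAcyclic_of_edgeSet_subset {V : Type*} {H Y : SimpleGraph V} {g : ℕ}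
    (hH : LocallySparse H g) (hY : Y ≤ H) (E : Finset (Sym2 V)) (hE : Y.edgeSet ⊆ E)
    (hg : E.card ≤ g) : Y.IsAcyclic := by
  classical
  intro v c hc
  have hA : c.edges.toFinset.card = c.length := by
    rw [List.toFinset_card_of_nodup hc.edges_nodup, SimpleGraph.Walk.length_edges]
  have hW : c.support.tail.toFinset.card ≤ c.length :=
    (List.toFinset_card_le _).trans (by simp)
  have hAE : c.edges.toFinset ⊆ E := fun e he =>
    hE (c.edges_subset_edgeSet (List.mem_toFinset.1 he))
  have hmem : ∀ u ∈ c.support, u ∈ c.support.tail := by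
    intro u hu
    rw [SimpleGraph.Walk.mem_support_iff] at hu
    rcases hu with rfl | hu
    · exact SimpleGraph.Walk.end_mem_tail_support hc.not_nil
    · exact hu
  have := hH c.support.tail.toFinset c.edges.toFinset
    (fun e he => SimpleGraph.edgeSet_mono hY
      (c.edges_subset_edgeSet (List.mem_toFinset.1 he)))
    (fun e he u hu => List.mem_toFinset.2 (hmem u
      (SimpleGraph.Walk.mem_support_of_mem_edges (List.mem_toFinset.1 he) hu)))
    ⟨v, List.mem_toFinset.2 (hmem v c.start_mem_support)⟩
    (by have := Finset.card_le_card hAE; omega)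
  omega

theorem LocallySparse.mono {V : Type*} {H : SimpleGraph V} {g g' : ℕ} (h : LocallySparse H g)
    (hg : g' ≤ g) : LocallySparse H g' :=
  fun W A hA hAW hW hWg => h W A hA hAW hW (hWg.trans hg)

/-! ### The `1`-subdivision -/

section OneSubdivision

variable {n : ℕ} {H : SimpleGraph (Fin n)}

instance : Finite (Edges H) :=
  inferInstanceAs (Finite {p : Fin n × Fin n // p.1 < p.2 ∧ H.Adj p.1 p.2})

theorem subdiv_one_adj_inl_inr {u : Fin n} {e : Edges H} {i : Fin 1} :
    (Subdiv H fun _ => 1).Adj (Sum.inl u) (Sum.inr ⟨e, i⟩) ↔ u = e.1.1 ∨ u = e.1.2 := by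
  simp [Subdiv, subdivRel]

theorem subdiv_one_isLeft_of_adj {x y : Fin n ⊕ Σ _ : Edges H, Fin 1}
    (h : (Subdiv H fun _ => 1).Adj x y) : x.isLeft ↔ ¬ y.isLeft := by
  rcases x with u | ⟨e, i⟩ <;> rcases y with v | ⟨e', j⟩ <;> simp [Subdiv, subdivRel] at h ⊢

/-- The vertex subdividing the edge `uv`. -/
abbrev edgePoint {u v : Fin n} (h : u < v ∧ H.Adj u v) : Fin n ⊕ Σ _ : Edges H, Fin 1 :=
  Sum.inr ⟨⟨(u, v), h⟩, 0⟩

theorem subdiv_one_adj_left_edgePoint {u v : Fin n} (h : u < v ∧ H.Adj u v) :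
    (Subdiv H fun _ => 1).Adj (Sum.inl u) (edgePoint h) :=
  subdiv_one_adj_inl_inr.2 (Or.inl rfl)

theorem subdiv_one_adj_right_edgePoint {u v : Fin n} (h : u < v ∧ H.Adj u v) :
    (Subdiv H fun _ => 1).Adj (Sum.inl v) (edgePoint h) :=
  subdiv_one_adj_inl_inr.2 (Or.inr rfl)

/-- The original vertex carried by an element of the subdivision (an end, for an edge). -/
def underlyingVertex : (Fin n ⊕ Σ _ : Edges H, Fin 1) → Fin n
  | Sum.inl u => u
  | Sum.inr ⟨e, _⟩ => e.1.1

/-- The original edge carried by an element of the subdivision (a loop, for a vertex). -/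
def underlyingEdge : (Fin n ⊕ Σ _ : Edges H, Fin 1) → Sym2 (Fin n)
  | Sum.inl u => s(u, u)
  | Sum.inr ⟨e, _⟩ => s(e.1.1, e.1.2)

theorem underlyingEdge_injOn :
    Set.InjOn (underlyingEdge (H := H)) {x | ¬ x.isLeft} := by
  rintro (u | ⟨⟨⟨a, b⟩, h⟩, i⟩) hx (v | ⟨⟨⟨a', b'⟩, h'⟩, j⟩) hy hxy
  · simp at hx
  · simp at hx
  · simp at hy
  · have hlt := h.1
    have hlt' := h'.1
    simp only [underlyingEdge, Sym2.eq_iff] at hxy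
    obtain rfl : i = j := Subsingleton.elim _ _
    rcases hxy with ⟨rfl, rfl⟩ | ⟨rfl, rfl⟩
    · rfl
    · exact absurd hlt hlt'.asymm

theorem card_isLeft_eq_card_not_isLeft {m : ℕ}
    (f : cycleGraph (m + 2) →g Subdiv H fun _ => 1) :
    Finset.card {i | (f i).isLeft} = Finset.card {i | ¬ (f i).isLeft} := by
  refine Finset.card_equiv (Equiv.addRight 1) fun i => ?_
  have hadj : (cycleGraph (m + 2)).Adj i (i + 1) := by simp [cycleGraph_adj]
  simpa using subdiv_one_isLeft_of_adj (f.map_adj hadj)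

theorem two_mul_card_isLeft {m : ℕ} (f : cycleGraph (m + 2) →g Subdiv H fun _ => 1) :
    2 * Finset.card {i | (f i).isLeft} = m + 2 := by
  have h := Finset.card_filter_add_card_filter_not (s := (Finset.univ : Finset (Fin (m + 2))))
    (fun i => ((f i).isLeft : Prop))
  rw [← card_isLeft_eq_card_not_isLeft f] at h
  simpa [two_mul] using h

theorem not_isSubgraphOf_cycleGraph_subdiv_one_of_odd {m : ℕ} (hm : 5 ≤ m) (hodd : Odd m) :
    ¬ IsSubgraphOf (cycleGraph m) (Subdiv H fun _ => 1) := by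
  rintro ⟨f, -⟩
  obtain ⟨m, rfl⟩ : ∃ l, m = l + 2 := ⟨m - 2, by omega⟩
  have := two_mul_card_isLeft f
  obtain ⟨r, hr⟩ := hodd
  omega

theorem LocallySparse.not_isSubgraphOf_cycleGraph_subdiv_one {k j : ℕ} (hH : LocallySparse H k)
    (hj : 2 ≤ j) (hjk : j ≤ k) :
    ¬ IsSubgraphOf (cycleGraph (2 * j)) (Subdiv H fun _ => 1) := by
  rintro ⟨f, hf⟩
  obtain ⟨m, hm⟩ : ∃ m, 2 * j = m + 2 := ⟨2 * j - 2, by omega⟩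
  revert f
  rw [hm]
  intro f hf
  have hL : Finset.card {i | (f i).isLeft} = j := by
    have := two_mul_card_isLeft f
    omega
  have hR : Finset.card {i | ¬ (f i).isLeft} = j := by rw [← card_isLeft_eq_card_not_isLeft, hL]
  let W : Finset (Fin n) :=
    Finset.image (fun i => underlyingVertex (f i)) {i | (f i).isLeft}
  let A : Finset (Sym2 (Fin n)) :=
    Finset.image (fun i => underlyingEdge (f i)) {i | ¬ (f i).isLeft}
  have hW : W.card ≤ j := Finset.card_image_le.trans hL.le
  have hA : A.card = j := by
    rw [← hR]
    refine Finset.card_image_of_injOn fun i hi i' hi' h => hf ?_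
    exact underlyingEdge_injOn (by simpa using hi) (by simpa using hi') h
  have hWne : W.Nonempty := by
    rw [Finset.image_nonempty, ← Finset.card_pos]
    omega
  have hmemW : ∀ {i u}, f i = Sum.inl u → u ∈ W := by
    intro i u hu
    exact Finset.mem_image.2 ⟨i, by simp [hu], by simp [hu, underlyingVertex]⟩
  have key := hH W A ?_ ?_ hWne (hW.trans hjk)
  · omega
  · intro s hs
    obtain ⟨i, hi, rfl⟩ := Finset.mem_image.1 hs
    rcases h : f i with u | ⟨e, r⟩
    · simp [h] at hi
    · exact e.2.2
  · intro s hs v hv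
    obtain ⟨i, hi, rfl⟩ := Finset.mem_image.1 hs
    have h₁ : (cycleGraph (m + 2)).Adj (i + 1) i := by simp [cycleGraph_adj]
    have h₂ : (cycleGraph (m + 2)).Adj (i - 1) i := by simp [cycleGraph_adj]
    have hne : i + 1 ≠ i - 1 := by
      intro h
      have h2 : (1 + 1 : Fin (m + 2)) = 0 := by
        have h3 : i + 1 - (i - 1) = 0 := sub_eq_zero.2 h
        rwa [add_sub_sub_cancel] at h3
      have h4 := congrArg Fin.val h2
      rw [Fin.val_add, Fin.val_one, Fin.val_zero, Nat.mod_eq_of_lt (by omega)] at h4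
      omega
    have g₁ := f.map_adj h₁
    have g₂ := f.map_adj h₂
    have l₁ := subdiv_one_isLeft_of_adj g₁
    have l₂ := subdiv_one_isLeft_of_adj g₂
    rcases h : f i with u | ⟨e, r⟩
    · simp [h] at hi
    rcases h₁' : f (i + 1) with u₁ | ⟨e₁, r₁⟩
    swap
    · simp [h, h₁'] at l₁
    rcases h₂' : f (i - 1) with u₂ | ⟨e₂, r₂⟩
    swap
    · simp [h, h₂'] at l₂
    rw [h, h₁', subdiv_one_adj_inl_inr] at g₁
    rw [h, h₂', subdiv_one_adj_inl_inr] at g₂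
    have hu : u₁ ≠ u₂ := by
      rintro rfl
      exact hne (hf (h₁'.trans h₂'.symm))
    have hv' : v = e.1.1 ∨ v = e.1.2 := by simpa [h, underlyingEdge] using hv
    have hv'' : v = u₁ ∨ v = u₂ := by grind
    rcases hv'' with rfl | rfl
    · exact hmemW h₁'
    · exact hmemW h₂'

theorem not_isSubgraphOf_triangle_subdiv_one :
    ¬ IsSubgraphOf (⊤ : SimpleGraph (Fin 3)) (Subdiv H fun _ => 1) := by
  rintro ⟨f, -⟩
  have h (i j : Fin 3) (hij : i ≠ j) := subdiv_one_isLeft_of_adj (f.map_adj (by simpa using hij))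
  have h01 := h 0 1 (by decide)
  have h12 := h 1 2 (by decide)
  have h02 := h 0 2 (by decide)
  tauto

theorem LocallySparse.exists_tree_subdiv_one {g : ℕ} (hn : 0 < n) (hH : LocallySparse H g)
    {T : SimpleGraph (Fin g)} (hT : IsSubgraphOf T (Subdiv H fun _ => 1)) :
    ∃ Y : SimpleGraph (Fin n), Y.Connected ∧ Y.IsAcyclic ∧
      IsSubgraphOf T (Subdiv Y fun _ => 1) := by
  obtain ⟨f, hf⟩ := hT
  let E : Finset (Sym2 (Fin n)) := Finset.univ.image fun t => underlyingEdge (f t)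
  have hEcard : E.card ≤ g := Finset.card_image_le.trans (by simp)
  have hle : fromEdgeSet (E : Set (Sym2 (Fin n))) ≤ H := by
    intro u v huv
    rw [fromEdgeSet_adj] at huv
    obtain ⟨huvE, hne⟩ := huv
    simp only [E, Finset.coe_image, Finset.coe_univ, Set.image_univ, Set.mem_range] at huvE
    obtain ⟨t, ht⟩ := huvE
    rcases h : f t with w | ⟨e, i⟩
    · simp only [h, underlyingEdge, Sym2.eq_iff] at ht
      grind
    · simp only [h, underlyingEdge] at ht
      rw [← mem_edgeSet, ← ht]
      exact e.2.2
  have hacyc := hH.isAcyclic_of_edgeSet_subset hle E (by simp) hEcard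
  have : Nonempty (Fin n) := ⟨⟨0, hn⟩⟩
  obtain ⟨Y, hEY, -, hY⟩ := (connected_top (V := Fin n)).exists_isTree_le_of_le_of_isAcyclic
    le_top hacyc
  refine ⟨Y, hY.connected, hY.isAcyclic, ?_⟩
  have hlift : ∀ t, ∃ y : Fin n ⊕ Σ _ : Edges Y, Fin 1, (∀ u, f t = Sum.inl u → y = Sum.inl u) ∧
      ∀ e i, f t = Sum.inr ⟨e, i⟩ → ∃ e' : Edges Y, e'.1 = e.1 ∧ y = Sum.inr ⟨e', i⟩ := by
    intro t
    rcases ht : f t with u | ⟨e, i⟩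
    · exact ⟨Sum.inl u, by simp⟩
    · have hadj : Y.Adj e.1.1 e.1.2 := hEY (by
        rw [fromEdgeSet_adj]
        refine ⟨?_, e.2.1.ne⟩
        simp only [E, Finset.coe_image, Finset.coe_univ, Set.image_univ, Set.mem_range]
        exact ⟨t, by rw [ht]; rfl⟩)
      refine ⟨Sum.inr ⟨⟨e.1, e.2.1, hadj⟩, i⟩, by simp, ?_⟩
      rintro e' i' h
      cases h
      exact ⟨⟨e.1, e.2.1, hadj⟩, rfl, rfl⟩
  choose F hF1 hF2 using hlift
  have hmixed : ∀ {s t : Fin g} {u : Fin n} {e : Edges H} {i : Fin 1}, T.Adj s t →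
      f s = Sum.inl u → f t = Sum.inr ⟨e, i⟩ → (Subdiv Y fun _ => 1).Adj (F s) (F t) := by
    intro s t u e i hst hs ht
    obtain ⟨e', he', hFt⟩ := hF2 t e i ht
    have h := f.map_adj hst
    rw [hs, ht, subdiv_one_adj_inl_inr] at h
    rw [hF1 s u hs, hFt, subdiv_one_adj_inl_inr, he']
    exact h
  refine ⟨⟨F, ?_⟩, ?_⟩
  · intro s t hst
    have hlr := subdiv_one_isLeft_of_adj (f.map_adj hst)
    rcases hs : f s with u | ⟨e, i⟩ <;> rcases ht : f t with v | ⟨e', i'⟩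
    · simp [hs, ht] at hlr
    · exact hmixed hst hs ht
    · exact (hmixed hst.symm ht hs).symm
    · simp [hs, ht] at hlr
  · intro s t hst
    change F s = F t at hst
    apply hf
    rcases hs : f s with u | ⟨e, i⟩ <;> rcases ht : f t with v | ⟨e', i'⟩
    · simpa [hF1 s u hs, hF1 t v ht] using hst
    · obtain ⟨e₁, -, h₁⟩ := hF2 t e' i' ht
      simp [hF1 s u hs, h₁] at hst
    · obtain ⟨e₁, -, h₁⟩ := hF2 s e i hs
      simp [hF1 t v ht, h₁] at hst
    · obtain ⟨e₁, he₁, h₁⟩ := hF2 s e i hs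
      obtain ⟨e₂, he₂, h₂⟩ := hF2 t e' i' ht
      rw [h₁, h₂] at hst
      cases hst
      have : e = e' := Subtype.ext (he₁.symm.trans he₂)
      rw [this]

theorem colorable_of_isStarColoring_subdiv_one {N : ℕ}
    {col : (Fin n ⊕ Σ _ : Edges H, Fin 1) → Fin N}
    (hcol : IsStarColoring (Subdiv H fun _ => 1) col) : H.Colorable (N * 2 ^ N) := by
  let b (u : Fin n) : Set (Fin N) :=
    {j | ∃ (v : Fin n) (h : u < v ∧ H.Adj u v),
      col (Sum.inl u) = col (Sum.inl v) ∧ col (edgePoint h) = j}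
  have hlt : ∀ {u v : Fin n}, u < v → H.Adj u v →
      (col (Sum.inl u), b u) ≠ (col (Sum.inl v), b v) := by
    intro u v huv hadj heq
    rw [Prod.mk.injEq] at heq
    obtain ⟨hc, hb⟩ := heq
    have hmem : col (edgePoint ⟨huv, hadj⟩) ∈ b v := hb ▸ ⟨v, ⟨huv, hadj⟩, hc, rfl⟩
    obtain ⟨w, hw, -, hjw⟩ := hmem
    refine hcol.2 (Sum.inl u) (edgePoint ⟨huv, hadj⟩) (Sum.inl v) (edgePoint hw)
      (subdiv_one_adj_left_edgePoint _) (subdiv_one_adj_right_edgePoint _).symm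
      (subdiv_one_adj_left_edgePoint _) (by simpa using huv.ne) ?_ (by simp) ⟨hc, hjw.symm⟩
    intro h
    have h' := congrArg underlyingVertex h
    exact huv.ne h'
  have C : H.Coloring (Fin N × Set (Fin N)) :=
    Coloring.mk (fun u => (col (Sum.inl u), b u)) fun {u v} hadj => by
      rcases lt_or_gt_of_ne hadj.ne with h | h
      · exact hlt h hadj
      · exact (hlt h hadj.symm).symm
  simpa using C.colorable

end OneSubdivision

theorem le_starChi_of_forall {V : Type*} [Finite V] {G : SimpleGraph V} {M : ℕ}
    (h : ∀ N, (∃ c : V → Fin N, IsStarColoring G c) → M ≤ N) : M ≤ starChi G := by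
  obtain ⟨n, ⟨e⟩⟩ := Finite.exists_equiv_fin V
  refine h _ (Nat.sInf_mem (s := {N | ∃ c : V → Fin N, IsStarColoring G c}) ⟨n, e, ?_, ?_⟩)
  · exact fun u v huv hc => huv.ne (e.injective hc)
  · exact fun x y z w _ _ _ hxz _ _ hc => hxz (e.injective hc.1)

theorem IsInducedSubgraphOf.isSubgraphOf {V W : Type*} {F : SimpleGraph V} {G : SimpleGraph W}
    (h : IsInducedSubgraphOf F G) : IsSubgraphOf F G :=
  let ⟨f⟩ := h
  ⟨f.toHom, f.injective⟩

theorem IsSubgraphOf.trans_iso {U V W : Type*} {F : SimpleGraph U} {G : SimpleGraph V}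
    {G' : SimpleGraph W} (h : IsSubgraphOf F G) (φ : G ≃g G') : IsSubgraphOf F G' :=
  let ⟨f, hf⟩ := h
  ⟨φ.toHom.comp f, φ.injective.comp hf⟩

theorem IsStarColoring.comp_iso {V W α : Type*} {G : SimpleGraph V} {G' : SimpleGraph W}
    {c : V → α} (hc : IsStarColoring G c) (φ : G' ≃g G) : IsStarColoring G' (c ∘ φ) :=
  ⟨fun _ _ h => hc.1 _ _ (φ.map_adj_iff.2 h), fun _ _ _ _ hxy hyz hzw hxz hyw hxw =>
    hc.2 _ _ _ _ (φ.map_adj_iff.2 hxy) (φ.map_adj_iff.2 hyz) (φ.map_adj_iff.2 hzw)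
      (φ.injective.ne hxz) (φ.injective.ne hyw) (φ.injective.ne hxw)⟩

/-- If the forest `T` is not a subgraph of the `1`-subdivision of any tree
and `k ≥ 1`, then the class of graphs that are `T`-free, `C_{2j}`-free for `2 ≤ j ≤ k`,
and with no induced odd cycle of length at least `5`, contains triangle-free graphs of
arbitrarily large star chromatic number (hence it is not `χ_s`-bounded). -/
theorem not_starChi_bounded_of_forest_not_sub_onesubdiv_tree
    (nT : ℕ) (T : SimpleGraph (Fin nT)) (hT : T.IsAcyclic)
    (hTnot : ¬ ∃ (m : ℕ) (Y : SimpleGraph (Fin m)), Y.Connected ∧ Y.IsAcyclic ∧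
        IsSubgraphOf T (Subdiv Y (fun _ => 1)))
    (k : ℕ) (hk : 1 ≤ k) :
    ∀ M : ℕ, ∃ (n : ℕ) (G : SimpleGraph (Fin n)),
      (¬ IsInducedSubgraphOf T G) ∧
      (∀ j : ℕ, 2 ≤ j → j ≤ k → ¬ IsInducedSubgraphOf (SimpleGraph.cycleGraph (2 * j)) G) ∧
      (∀ m : ℕ, 5 ≤ m → Odd m → ¬ IsInducedSubgraphOf (SimpleGraph.cycleGraph m) G) ∧
      (¬ IsSubgraphOf (⊤ : SimpleGraph (Fin 3)) G) ∧
      M ≤ starChi G := by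
  intro M
  obtain ⟨n, H, hn, hH, hcol⟩ := exists_locallySparse_not_colorable (max nT k) (M * 2 ^ M)
  obtain ⟨n', ⟨e⟩⟩ := Finite.exists_equiv_fin (Fin n ⊕ Σ _ : Edges H, Fin 1)
  let φ := SimpleGraph.Iso.comap e.symm (Subdiv H fun _ => 1)
  refine ⟨n', (Subdiv H fun _ => 1).comap e.symm, fun h => hTnot ?_, fun j hj hjk h => ?_,
    fun m hm hodd h => ?_, fun h => ?_, ?_⟩
  · exact ⟨n, (hH.mono (le_max_left _ _)).exists_tree_subdiv_one hn (h.isSubgraphOf.trans_iso φ)⟩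
  · exact (hH.mono (le_max_right _ _)).not_isSubgraphOf_cycleGraph_subdiv_one hj hjk
      (h.isSubgraphOf.trans_iso φ)
  · exact not_isSubgraphOf_cycleGraph_subdiv_one_of_odd hm hodd (h.isSubgraphOf.trans_iso φ)
  · exact not_isSubgraphOf_triangle_subdiv_one (h.trans_iso φ)
  · refine le_starChi_of_forall ?_
    rintro N ⟨c, hc⟩
    by_contra! hNM
    refine hcol ((colorable_of_isStarColoring_subdiv_one (hc.comp_iso φ.symm)).mono ?_)
    gcongr
    norm_num
end
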